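/- Let D ⊂ ℂ be a domain and let ρ : D → [-∞,∞) be a subharmonic function that is bounded from below. Then every f ∈ L²_h(G_{D,ρ}) extends to a (unique) holomorphic function F on G_{D̂,ρ̂} with F ∈ L²_h(G_{D̂,ρ̂}); that is, the restriction map L²_h(G_{D̂,ρ̂}) → L²_h(G_{D,ρ}) is a bijection. -/

import Mathlib

open MeasureTheory Filter Metric Set

/-- `elog x` is `log x` with value `-∞` for `x ≤ 0`, as an extended real. -/
noncomputable def elog (x : ℝ) : EReal := if x ≤ 0 then ⊥ else ((Real.log x : ℝ) : EReal)

/-- The sub-mean value inequality over circles of closed discs contained in `Ω`, phrased via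
continuous real-valued majorants of the (extended-real-valued) function on the circle. -/
def SubmeanOn (u : ℂ → EReal) (Ω : Set ℂ) : Prop :=
  ∀ c : ℂ, ∀ r : ℝ, 0 < r → Metric.closedBall c r ⊆ Ω →
    ∀ φ : ℝ → ℝ, Continuous φ →
      (∀ θ : ℝ, u (c + r * Complex.exp (θ * Complex.I)) ≤ ((φ θ : ℝ) : EReal)) →
      u c ≤ (((2 * Real.pi)⁻¹ * ∫ θ in (0:ℝ)..(2 * Real.pi), φ θ : ℝ) : EReal)

/-- `u : Ω → [-∞, ∞)` is subharmonic on the open set `Ω ⊆ ℂ`: upper semicontinuous,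
nowhere `+∞`, not identically `-∞` on any connected component, sub-mean value inequality. -/
def SubharmonicOn (u : ℂ → EReal) (Ω : Set ℂ) : Prop :=
  IsOpen Ω ∧ UpperSemicontinuousOn u Ω ∧
  (∀ z ∈ Ω, u z ≠ ⊤) ∧
  (∀ z ∈ Ω, ∃ w ∈ connectedComponentIn Ω z, u w ≠ ⊥) ∧
  SubmeanOn u Ω

/-- A set `E ⊆ ℂ` is polar if some subharmonic function on an open set containing `E`
equals `-∞` on `E`. -/
def PolarSet (E : Set ℂ) : Prop :=
  ∃ Ω : Set ℂ, E ⊆ Ω ∧ ∃ u : ℂ → EReal, SubharmonicOn u Ω ∧ ∀ z ∈ E, u z = ⊥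

/-- The space of square-integrable holomorphic functions on `D`. -/
def L2h {E : Type*} [NormedAddCommGroup E] [NormedSpace ℂ E] [MeasureSpace E]
    (D : Set E) : Set (E → ℂ) :=
  {f | DifferentiableOn ℂ f D ∧ IntegrableOn (fun z => ‖f z‖ ^ 2) D volume}

/-- `D` is an `L²ₕ`-domain of holomorphy. -/
def IsL2hDomainOfHolomorphy {E : Type*} [NormedAddCommGroup E] [NormedSpace ℂ E]
    [MeasureSpace E] (D : Set E) : Prop :=
  ¬ ∃ D₀ D₁ : Set E, IsOpen D₀ ∧ IsConnected D₀ ∧ IsOpen D₁ ∧ IsConnected D₁ ∧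
      D₀ ⊆ D₁ ∩ D ∧ ¬ (D₁ ⊆ D) ∧
      ∀ f ∈ L2h D, ∃ g : E → ℂ, DifferentiableOn ℂ g D₁ ∧ Set.EqOn g f D₀

/-- The Hartogs domain `G_{D,ρ} = {(z₁,z₂) : z₁ ∈ D, |z₂| < e^{-ρ(z₁)}}`. -/
def hartogs (D : Set ℂ) (ρ : ℂ → EReal) : Set (ℂ × ℂ) :=
  {p | p.1 ∈ D ∧ elog ‖p.2‖ < - ρ p.1}

/-- `S(D)`: boundary points near which the complement of `D` is polar. -/
def polarS (D : Set ℂ) : Set ℂ :=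
  {z ∈ frontier D | ∃ U : Set ℂ, IsOpen U ∧ z ∈ U ∧ PolarSet (U \ D)}

/-- `fj` is the family of coefficients of a Hartogs expansion of `f` on `G_{D,ρ}`. -/
def HartogsExpansion (D : Set ℂ) (ρ : ℂ → EReal) (f : ℂ × ℂ → ℂ) (fj : ℕ → ℂ → ℂ) : Prop :=
  (∀ j, DifferentiableOn ℂ (fj j) D) ∧
  ∀ p ∈ hartogs D ρ, HasSum (fun j => fj j p.1 * p.2 ^ j) (f p)

/-- `ρ_f(z) = limsup_j (1/j) log |f_j(z)|` for coefficients `fj`. -/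
noncomputable def coeffGrowth (fj : ℕ → ℂ → ℂ) (z : ℂ) : EReal :=
  Filter.limsup (fun (j : ℕ) => ((((j : ℝ)⁻¹ : ℝ)) : EReal) * elog ‖fj j z‖) Filter.atTop

/-- The upper semicontinuous regularization `g*`. -/
noncomputable def uscReg (g : ℂ → EReal) (z : ℂ) : EReal := Filter.limsup g (nhds z)

/-- `ρ̃ = sup_{f ∈ L²ₕ(G_{D,ρ})} (ρ_f)*`. -/
noncomputable def rhoTilde (D : Set ℂ) (ρ : ℂ → EReal) (z : ℂ) : EReal :=
  ⨆ fj ∈ {fj : ℕ → ℂ → ℂ | ∃ f ∈ L2h (hartogs D ρ), HartogsExpansion D ρ f fj},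
    uscReg (coeffGrowth fj) z

/-- `D̂ = D ∪ {z ∈ S(D) : limsup_{D ∋ w → z} ρ(w) < ∞}`. -/
def DHat (D : Set ℂ) (ρ : ℂ → EReal) : Set ℂ :=
  D ∪ {z ∈ polarS D | Filter.limsup ρ (nhdsWithin z D) < ⊤}

open Classical in
/-- `ρ̂`, extending `ρ` to `D̂` by boundary limsups. -/
noncomputable def rhoHat (D : Set ℂ) (ρ : ℂ → EReal) (z : ℂ) : EReal :=
  if z ∈ D then ρ z else Filter.limsup ρ (nhdsWithin z D)

/-- `u` is plurisubharmonic on an open `Ω ⊆ ℂⁿ`. -/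
def PlurisubharmonicOn {n : ℕ} (u : (Fin n → ℂ) → EReal) (Ω : Set (Fin n → ℂ)) : Prop :=
  IsOpen Ω ∧ UpperSemicontinuousOn u Ω ∧
  (∀ z ∈ Ω, u z ≠ ⊤) ∧
  (∀ z ∈ Ω, ∃ w ∈ connectedComponentIn Ω z, u w ≠ ⊥) ∧
  ∀ a b : Fin n → ℂ, SubmeanOn (fun lam => u (a + lam • b)) {lam : ℂ | a + lam • b ∈ Ω}

/-- A set `E ⊆ ℂⁿ` is pluripolar. -/
def PluripolarSet {n : ℕ} (E : Set (Fin n → ℂ)) : Prop :=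
  ∃ Ω : Set (Fin n → ℂ), E ⊆ Ω ∧
    ∃ u : (Fin n → ℂ) → EReal, PlurisubharmonicOn u Ω ∧ ∀ z ∈ E, u z = ⊥

/-- `D ⊆ ℂⁿ` is pseudoconvex: it admits a plurisubharmonic exhaustion function. -/
def IsPseudoconvex {n : ℕ} (D : Set (Fin n → ℂ)) : Prop :=
  ∃ u : (Fin n → ℂ) → EReal, PlurisubharmonicOn u D ∧
    ∀ c : ℝ, IsCompact {z | z ∈ D ∧ u z ≤ (c : EReal)}

/-- `L²ₕ(D)` is infinite dimensional: arbitrarily many elements that are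
linearly independent as functions on `D`. -/
def L2hInfiniteDim {E : Type*} [NormedAddCommGroup E] [NormedSpace ℂ E] [MeasureSpace E]
    (D : Set E) : Prop :=
  ∀ N : ℕ, ∃ fs : Fin N → E → ℂ, (∀ i, fs i ∈ L2h D) ∧
    ∀ c : Fin N → ℂ, (∀ z ∈ D, ∑ i, c i * fs i z = 0) → c = 0

/-- A nonnegative lower semicontinuous function is a pointwise limit of continuous nonnegative
minorants. -/
theorem exists_continuous_minorants {X : Type*} [PseudoMetricSpace X] {h : X → ℝ}
    (hl : LowerSemicontinuous h) (h0 : ∀ x, 0 ≤ h x) :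
    ∃ H : ℕ → X → ℝ, (∀ k, Continuous (H k)) ∧ (∀ k x, 0 ≤ H k x) ∧ (∀ k x, H k x ≤ h x) ∧
      ∀ x, Tendsto (fun k => H k x) atTop (nhds (h x)) := by
  have hb : ∀ (k : ℕ) x, BddBelow (range fun y => h y + k * dist x y) := fun k x =>
    ⟨0, by rintro _ ⟨y, rfl⟩; exact add_nonneg (h0 y) (by positivity)⟩
  have hle : ∀ (k : ℕ) x, (⨅ y, (h y + k * dist x y)) ≤ h x := fun k x =>
    (ciInf_le (hb k x) x).trans (by simp)
  refine ⟨fun k x => ⨅ y, (h y + k * dist x y), fun k => ?_, fun k x => ?_, hle, fun x => ?_⟩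
  · refine (LipschitzWith.of_le_add_mul (k : NNReal) fun x y => ?_).continuous
    have : Nonempty X := ⟨x⟩
    rw [← sub_le_iff_le_add]
    refine le_ciInf fun z => ?_
    have h1 := ciInf_le (hb k x) z
    have h2 : (k : ℝ) * dist x z ≤ k * (dist x y + dist y z) := by
      gcongr; exact dist_triangle _ _ _
    simp only [NNReal.coe_natCast]
    linarith
  · exact Real.iInf_nonneg fun y => add_nonneg (h0 y) (by positivity)
  · rw [Metric.tendsto_atTop]
    intro ε hε
    obtain ⟨δ, hδ, hball⟩ := Metric.eventually_nhds_iff.1 (hl x (h x - ε / 2) (by linarith))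
    obtain ⟨n, hn⟩ := exists_nat_gt (h x / δ)
    refine ⟨n, fun k hk => ?_⟩
    have : Nonempty X := ⟨x⟩
    have h1 : h x - ε / 2 ≤ ⨅ y, (h y + k * dist x y) := by
      refine le_ciInf fun y => ?_
      by_cases hy : dist y x < δ
      · have := hball hy
        have : 0 ≤ (k : ℝ) * dist x y := by positivity
        linarith
      · have h3 : h x < n * δ := (div_lt_iff₀ hδ).1 hn
        have h4 : (n : ℝ) * δ ≤ k * dist x y := by
          rw [dist_comm]
          have : (n : ℝ) ≤ k := by exact_mod_cast hk
          gcongr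
          linarith
        have := h0 y
        linarith
    have h2 := hle k x
    rw [Real.dist_eq, abs_lt]
    constructor <;> linarith

/-- Integration over a disc by averaging over concentric circles. -/
theorem setIntegral_closedBall_eq_circleAverage {E : Type*} [NormedAddCommGroup E]
    [NormedSpace ℝ E] [CompleteSpace E] {G : ℂ → E} {c : ℂ} {r : ℝ}
    (hG : ContinuousOn G (closedBall c r)) :
    ∫ x in closedBall c r, G x = ∫ x in closedBall (0 : ℂ) r, Real.circleAverage G c ‖x‖ := by
  have hrot : ∀ θ : ℝ, ∫ x in closedBall c r, G x
      = ∫ x in closedBall (0 : ℂ) r, G (c + Complex.exp (θ * Complex.I) * x) := by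
    intro θ
    let e : ℂ ≃ᵢ ℂ := (rotation (Circle.exp θ)).toIsometryEquiv.trans (IsometryEquiv.addLeft c)
    have he : MeasurePreserving e volume volume :=
      (measurePreserving_add_left volume c).comp (rotation (Circle.exp θ)).measurePreserving
    have := he.setIntegral_preimage_emb e.toHomeomorph.measurableEmbedding G (closedBall c r)
    rw [← this]
    have hpre : e ⁻¹' closedBall c r = closedBall 0 r := by
      ext x
      change dist (c + rotation (Circle.exp θ) x) c ≤ r ↔ dist x 0 ≤ r
      simp [dist_eq_norm]
    rw [hpre]
    simp [e]
  have hcirc : ∀ x : ℂ, Real.circleAverage G c ‖x‖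
      = (2 * Real.pi)⁻¹ • ∫ θ in (0:ℝ)..2 * Real.pi, G (c + Complex.exp (θ * Complex.I) * x) := by
    intro x
    rw [Real.circleAverage_eq_integral_add x.arg]
    congr 2
    ext θ
    rw [circleMap]
    congr 2
    push_cast
    conv_rhs => rw [← Complex.norm_mul_exp_arg_mul_I x]
    rw [add_mul, Complex.exp_add]
    ring
  simp_rw [hcirc]
  rw [integral_smul, ← intervalIntegral_integral_swap]
  · simp_rw [← hrot]
    simp only [intervalIntegral.integral_const, sub_zero, smul_smul, mul_inv]
    rw [show 2⁻¹ * Real.pi⁻¹ * (2 * Real.pi) = 1 by field_simp, one_smul]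
  · rw [Measure.prod_restrict, ← Measure.volume_eq_prod]
    have hc : ContinuousOn (Function.uncurry fun (θ : ℝ) (x : ℂ) =>
        G (c + Complex.exp (θ * Complex.I) * x)) (Icc 0 (2 * Real.pi) ×ˢ closedBall 0 r) := by
      refine hG.comp (by fun_prop) ?_
      rintro ⟨θ, x⟩ ⟨-, hx⟩
      simpa [Complex.norm_exp_ofReal_mul_I] using hx
    refine (hc.integrableOn_compact (isCompact_Icc.prod (isCompact_closedBall _ _))).mono_set ?_
    refine prod_mono ?_ le_rfl
    rw [uIoc_of_le (by positivity)]
    exact Ioc_subset_Icc_self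

/-- Circle super-mean inequality for continuous minorants implies the disc super-mean
inequality. -/
theorem setIntegral_closedBall_le_of_circle_minorant {h : ℂ → ℝ} (hl : LowerSemicontinuous h)
    (h0 : ∀ x, 0 ≤ h x) (h1 : ∀ x, h x ≤ 1) {c : ℂ} {r : ℝ}
    (hs : ∀ s, 0 < s → s ≤ r → ∀ ψ : ℂ → ℝ, Continuous ψ → (∀ x, ψ x ≤ h x) →
      Real.circleAverage ψ c s ≤ h c) :
    ∫ x in closedBall c r, h x ≤ volume.real (closedBall c r) * h c := by
  obtain ⟨H, Hc, H0, Hle, Hlim⟩ := exists_continuous_minorants hl h0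
  have hT : Tendsto (fun k => ∫ x in closedBall c r, H k x) atTop
      (nhds (∫ x in closedBall c r, h x)) := by
    refine tendsto_integral_of_dominated_convergence (fun _ => (1 : ℝ))
      (fun k => (Hc k).aestronglyMeasurable) ?_ (fun k => ae_of_all _ fun x => ?_)
      (ae_of_all _ Hlim)
    · exact integrableOn_const (isCompact_closedBall c r).measure_lt_top.ne
    · rw [Real.norm_of_nonneg (H0 k x)]
      exact (Hle k x).trans (h1 x)
  refine le_of_tendsto' hT fun k => ?_
  rw [setIntegral_closedBall_eq_circleAverage (Hc k).continuousOn]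
  have hvol : volume.real (closedBall c r) = volume.real (closedBall (0 : ℂ) r) := by
    simp [Measure.real, Complex.volume_closedBall]
  have hA : ∀ x ∈ closedBall (0 : ℂ) r, Real.circleAverage (H k) c ‖x‖ ≤ h c := by
    intro x hx
    rcases eq_or_ne x 0 with rfl | hx0
    · simpa using Hle k c
    · exact hs _ (norm_pos_iff.2 hx0) (by simpa using hx) _ (Hc k) (Hle k)
  calc ∫ x in closedBall (0 : ℂ) r, Real.circleAverage (H k) c ‖x‖
      ≤ ∫ x in closedBall (0 : ℂ) r, h c := by
        refine integral_mono_of_nonneg (ae_of_all _ fun x => ?_)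
          (integrableOn_const (isCompact_closedBall _ r).measure_lt_top.ne)
          ((ae_restrict_iff' measurableSet_closedBall).2 (ae_of_all _ hA))
        exact Real.circleAverage_nonneg_of_nonneg fun y _ => H0 k y
    _ = _ := by rw [setIntegral_const, smul_eq_mul, hvol]

/-- The truncation `min (M - u) N / N` of `M - u` on `B`, extended by `0`. -/
noncomputable def truncation (u : ℂ → EReal) (B : Set ℂ) (M N : ℝ) : ℂ → ℝ :=
  B.indicator fun x => (M - (max (u x) ((M - N : ℝ) : EReal)).toReal) / N

section Truncation

variable {u : ℂ → EReal} {B : Set ℂ} {M N : ℝ} {x : ℂ}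

theorem coe_toReal_max (hM : u x < M) :
    (((max (u x) ((M - N : ℝ) : EReal)).toReal : ℝ) : EReal)
      = max (u x) ((M - N : ℝ) : EReal) := by
  refine EReal.coe_toReal ?_ ?_
  · exact (max_lt (hM.trans (EReal.coe_lt_top M)) (EReal.coe_lt_top _)).ne
  · exact ((EReal.bot_lt_coe (M - N)).trans_le (le_max_right _ _)).ne'

theorem truncation_of_mem (hx : x ∈ B) :
    truncation u B M N x = (M - (max (u x) ((M - N : ℝ) : EReal)).toReal) / N :=
  indicator_of_mem hx _

theorem truncation_le_iff (hN : 0 < N) (hx : x ∈ B) (hM : u x < M) {a : ℝ} :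
    a ≤ truncation u B M N x ↔ u x ≤ ((M - a * N : ℝ) : EReal) ∧ a ≤ 1 := by
  rw [truncation_of_mem hx, le_div_iff₀ hN, le_sub_comm, ← EReal.coe_le_coe_iff,
    coe_toReal_max hM, max_le_iff, EReal.coe_le_coe_iff]
  refine and_congr_right fun _ => ?_
  rw [sub_le_sub_iff_left]
  constructor
  · intro h; by_contra! h'; nlinarith
  · intro h; nlinarith

theorem truncation_lt_iff (hN : 0 < N) (hx : x ∈ B) (hM : u x < M) {a : ℝ} :
    a < truncation u B M N x ↔ u x < ((M - a * N : ℝ) : EReal) ∧ a < 1 := by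
  rw [truncation_of_mem hx, lt_div_iff₀ hN, lt_sub_comm, ← EReal.coe_lt_coe_iff,
    coe_toReal_max hM, max_lt_iff, EReal.coe_lt_coe_iff]
  refine and_congr_right fun _ => ?_
  rw [sub_lt_sub_iff_left]
  constructor
  · intro h; by_contra! h'; nlinarith
  · intro h; nlinarith

theorem truncation_nonneg (hN : 0 < N) (hM : ∀ x ∈ B, u x < M) (x : ℂ) :
    0 ≤ truncation u B M N x := by
  by_cases hx : x ∈ B
  · rw [truncation_le_iff hN hx (hM x hx)]
    simpa using (hM x hx).le
  · exact (indicator_of_notMem hx _).ge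

theorem truncation_le_one (hN : 0 < N) (hM : ∀ x ∈ B, u x < M) (x : ℂ) :
    truncation u B M N x ≤ 1 := by
  by_cases hx : x ∈ B
  · by_contra! h
    exact lt_irrefl _ ((truncation_lt_iff hN hx (hM x hx)).1 h).2
  · exact (indicator_of_notMem hx _).trans_le zero_le_one

theorem truncation_eq_one (hN : 0 < N) (hM : ∀ x ∈ B, u x < M) (hx : x ∈ B)
    (hux : u x ≤ ((M - N : ℝ) : EReal)) : truncation u B M N x = 1 := by
  refine le_antisymm (truncation_le_one hN hM x) ?_
  rw [truncation_le_iff hN hx (hM x hx)]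
  simpa using hux

theorem lowerSemicontinuous_truncation (hN : 0 < N) (hB : IsOpen B)
    (hu : UpperSemicontinuousOn u B) (hM : ∀ x ∈ B, u x < M) :
    LowerSemicontinuous (truncation u B M N) := by
  intro x a ha
  change a < truncation u B M N x at ha
  by_cases hx : x ∈ B
  · rw [truncation_lt_iff hN hx (hM x hx)] at ha
    have h1 := hu x hx _ ha.1
    rw [hB.nhdsWithin_eq hx] at h1
    filter_upwards [h1, hB.mem_nhds hx] with y hy hyB
    exact (truncation_lt_iff hN hyB (hM y hyB)).2 ⟨hy, ha.2⟩
  · rw [show truncation u B M N x = 0 from indicator_of_notMem hx _] at ha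
    exact Eventually.of_forall fun y => ha.trans_le (truncation_nonneg hN hM y)

theorem circleAverage_le_truncation (hN : 0 < N) (hM : ∀ x ∈ B, u x < M)
    (hu : SubmeanOn u B) {c : ℂ} {s : ℝ} (hs : 0 < s) (hB : closedBall c s ⊆ B)
    {ψ : ℂ → ℝ} (hψ : Continuous ψ) (hle : ∀ x, ψ x ≤ truncation u B M N x) :
    Real.circleAverage ψ c s ≤ truncation u B M N c := by
  have hcB : c ∈ B := hB (mem_closedBall_self hs.le)
  have hψc : Continuous fun θ : ℝ => ψ (circleMap c s θ) := hψ.comp (continuous_circleMap c s)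
  rw [truncation_le_iff hN hcB (hM c hcB)]
  constructor
  · have h := hu c s hs hB (fun θ => M - ψ (circleMap c s θ) * N) (by fun_prop) fun θ => ?_
    · convert h using 2
      have hi : IntervalIntegrable (fun θ => ψ (circleMap c s θ) * N) volume 0 (2 * Real.pi) :=
        (hψc.mul continuous_const).intervalIntegrable _ _
      rw [intervalIntegral.integral_sub intervalIntegrable_const hi,
        intervalIntegral.integral_mul_const, Real.circleAverage, smul_eq_mul]
      simp only [intervalIntegral.integral_const, sub_zero, smul_eq_mul]
      field_simp
    · have hmem : circleMap c s θ ∈ B := hB (circleMap_mem_closedBall c hs.le θ)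
      exact ((truncation_le_iff hN hmem (hM _ hmem)).1 (hle (circleMap c s θ))).1
  · refine Real.circleAverage_mono_on_of_le_circle ?_ fun x _ =>
      (hle x).trans (truncation_le_one hN hM x)
    exact hψ.continuousOn.circleIntegrable'

theorem setIntegral_truncation_le (hN : 0 < N) (hB : IsOpen B)
    (huc : UpperSemicontinuousOn u B) (hM : ∀ x ∈ B, u x < M)
    (hu : SubmeanOn u B) {c : ℂ} {r : ℝ} (hcB : closedBall c r ⊆ B) :
    ∫ x in closedBall c r, truncation u B M N x
      ≤ volume.real (closedBall c r) * truncation u B M N c :=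
  setIntegral_closedBall_le_of_circle_minorant (lowerSemicontinuous_truncation hN hB huc hM)
    (truncation_nonneg hN hM) (truncation_le_one hN hM) fun _ hs hsr _ hψ hle =>
      circleAverage_le_truncation hN hM hu hs ((closedBall_subset_closedBall hsr).trans hcB) hψ hle

theorem tendsto_truncation (hM : ∀ x ∈ B, u x < M) (hx : x ∈ B → u x ≠ ⊥) :
    Tendsto (fun n : ℕ => truncation u B M (n + 1) x) atTop (nhds 0) := by
  by_cases hxB : x ∈ B
  · have hc : ((u x).toReal : EReal) = u x :=
      EReal.coe_toReal (ne_top_of_lt (hM x hxB)) (hx hxB)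
    have h1 : ∀ n : ℕ, truncation u B M (n + 1) x ≤ (M - (u x).toReal) * (1 / ((n : ℝ) + 1)) := by
      intro n
      by_contra! h
      have := ((truncation_lt_iff (by positivity) hxB (hM x hxB)).1 h).1
      rw [mul_assoc, one_div_mul_cancel (by positivity), mul_one, sub_sub_cancel, hc] at this
      exact lt_irrefl _ this
    have h2 := (tendsto_one_div_add_atTop_nhds_zero_nat (𝕜 := ℝ)).const_mul (M - (u x).toReal)
    rw [mul_zero] at h2
    exact squeeze_zero (fun n => truncation_nonneg (by positivity) hM x) h1 h2
  · simp [truncation, hxB]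

end Truncation

theorem SubmeanOn.mono {u : ℂ → EReal} {Ω B : Set ℂ} (hu : SubmeanOn u Ω) (h : B ⊆ Ω) :
    SubmeanOn u B := fun c r hr hc => hu c r hr (hc.trans h)

theorem SubharmonicOn.exists_ball_lt {u : ℂ → EReal} {Ω : Set ℂ} (hu : SubharmonicOn u Ω) {z : ℂ}
    (hz : z ∈ Ω) : ∃ r > 0, ∃ M : ℝ, ball z r ⊆ Ω ∧ ∀ x ∈ ball z r, u x < M := by
  obtain ⟨M, hM⟩ := EReal.lt_iff_exists_real_btwn.1 (lt_top_iff_ne_top.2 (hu.2.2.1 z hz))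
  have h1 := hu.2.1 z hz _ hM.1
  rw [hu.1.nhdsWithin_eq hz] at h1
  obtain ⟨r, hr, hball⟩ := Metric.mem_nhds_iff.1 (inter_mem h1 (hu.1.mem_nhds hz))
  exact ⟨r, hr, M, fun x hx => (hball hx).2, fun x hx => (hball hx).1⟩

/-- Around a point where it is finite, a subharmonic function is finite almost everywhere. -/
theorem volume_setOf_eq_bot_inter_closedBall {u : ℂ → EReal} {B : Set ℂ} (hB : IsOpen B)
    (huc : UpperSemicontinuousOn u B) {M : ℝ} (hM : ∀ x ∈ B, u x < M)
    (hu : SubmeanOn u B) {c : ℂ} {r : ℝ} (hcB : closedBall c r ⊆ B)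
    (hc : u c ≠ ⊥) : volume ({x | u x = ⊥} ∩ closedBall c r) = 0 := by
  set A := {x | u x = ⊥} ∩ closedBall c r with hA
  have hfin : volume A ≠ ⊤ :=
    ((measure_mono inter_subset_right).trans_lt (isCompact_closedBall c r).measure_lt_top).ne
  have hcont := fun n : ℕ => lowerSemicontinuous_truncation (N := (n : ℝ) + 1)
    (by positivity) hB huc hM
  have hint : ∀ n : ℕ, IntegrableOn (truncation u B M (n + 1)) (closedBall c r) := fun n =>
    Measure.integrableOn_of_bounded (isCompact_closedBall c r).measure_lt_top.ne
      (hcont n).measurable.aestronglyMeasurable (M := 1) (ae_of_all _ fun x => by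
        rw [Real.norm_of_nonneg (truncation_nonneg (by positivity) hM x)]
        exact truncation_le_one (by positivity) hM x)
  have hmeas : volume.real A ≤ 0 := by
    have hlim := (tendsto_truncation (M := M) hM fun _ => hc).const_mul
      (volume.real (closedBall c r))
    rw [mul_zero] at hlim
    refine ge_of_tendsto' hlim fun n => ?_
    refine le_trans ?_ (setIntegral_truncation_le (by positivity) hB huc hM hu hcB)
    have hsub : A ⊆ {x | 1 ≤ truncation u B M (n + 1) x} := fun x hx =>
      (truncation_eq_one (by positivity) hM (hcB hx.2) (by rw [hx.1]; exact bot_le)).ge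
    have hmk := mul_meas_ge_le_integral_of_nonneg
      (ae_of_all _ (truncation_nonneg (by positivity) hM)) (hint n) 1
    rw [one_mul] at hmk
    refine le_trans ?_ hmk
    rw [measureReal_restrict_apply (measurableSet_le measurable_const (hcont n).measurable)]
    refine measureReal_mono (subset_inter hsub inter_subset_right) ?_
    exact ((measure_mono inter_subset_right).trans_lt (isCompact_closedBall c r).measure_lt_top).ne
  have := le_antisymm hmeas measureReal_nonneg
  exact (measureReal_eq_zero_iff hfin).1 this

/-- The set where a subharmonic function is `-∞` is locally null. -/
theorem SubharmonicOn.exists_volume_inter_ball_eq_zero {u : ℂ → EReal} {Ω : Set ℂ}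
    (hu : SubharmonicOn u Ω) {z : ℂ} (hz : z ∈ Ω) :
    ∃ r > 0, volume ({x | u x = ⊥} ∩ ball z r) = 0 := by
  have key : ∀ y ∈ Ω, ∃ r > 0, (∀ x ∈ ball y r, u x = ⊥) ∨
      volume ({x | u x = ⊥} ∩ ball y r) = 0 := by
    intro y hy
    obtain ⟨r, hr, M, hsub, hM⟩ := hu.exists_ball_lt hy
    refine ⟨r / 4, by positivity, ?_⟩
    by_cases h : ∀ x ∈ ball y (r / 4), u x = ⊥
    · exact Or.inl h
    · push Not at h
      obtain ⟨c, hc, hcu⟩ := h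
      rw [mem_ball] at hc
      right
      refine measure_mono_null (inter_subset_inter_right _ ?_)
        (volume_setOf_eq_bot_inter_closedBall isOpen_ball (hu.2.1.mono hsub) hM
          (hu.2.2.2.2.mono hsub) (c := c) (r := r / 2) ?_ hcu)
      · refine (ball_subset_ball' ?_).trans ball_subset_closedBall
        rw [dist_comm]; linarith
      · exact closedBall_subset_ball' (by linarith)
  let U : Set ℂ := {y | ∃ r > 0, ∀ x ∈ ball y r, u x = ⊥}
  let V : Set ℂ := {y | ∃ r > 0, volume ({x | u x = ⊥} ∩ ball y r) = 0}
  have hU : IsOpen U := by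
    rw [Metric.isOpen_iff]
    rintro y ⟨r, hr, h⟩
    refine ⟨r / 2, by positivity, fun w hw => ⟨r / 2, by positivity, fun x hx => h x ?_⟩⟩
    exact ball_subset_ball' (by rw [mem_ball] at hw; linarith) hx
  have hV : IsOpen V := by
    rw [Metric.isOpen_iff]
    rintro y ⟨r, hr, h⟩
    refine ⟨r / 2, by positivity, fun w hw => ⟨r / 2, by positivity, measure_mono_null ?_ h⟩⟩
    exact inter_subset_inter_right _ (ball_subset_ball' (by rw [mem_ball] at hw; linarith))
  have hdisj : Disjoint U V := by
    rw [Set.disjoint_left]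
    rintro y ⟨r, hr, h⟩ ⟨s, hs, h'⟩
    have hsub : ball y (min r s) ⊆ {x | u x = ⊥} ∩ ball y s := fun x hx =>
      ⟨h x (ball_subset_ball (min_le_left _ _) hx), ball_subset_ball (min_le_right _ _) hx⟩
    have : volume (ball y (min r s)) = 0 := measure_mono_null hsub h'
    exact (measure_ball_pos volume y (lt_min hr hs)).ne' this
  have hcover : connectedComponentIn Ω z ⊆ U ∪ V := fun y hy => by
    obtain ⟨r, hr, h⟩ := key y (connectedComponentIn_subset _ _ hy)
    exact h.imp (fun h => ⟨r, hr, h⟩) (fun h => ⟨r, hr, h⟩)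
  obtain ⟨w, hw, hwu⟩ := hu.2.2.2.1 z hz
  rcases isPreconnected_connectedComponentIn.subset_or_subset hU hV hdisj hcover with h | h
  · obtain ⟨r, hr, h'⟩ := h hw
    exact absurd (h' w (mem_ball_self hr)) hwu
  · exact h (mem_connectedComponentIn hz)

/-- Superharmonic `[0,1]`-valued functions equal to `1` near the poles and small in `L¹`. -/
theorem SubharmonicOn.exists_truncations {u : ℂ → EReal} {Ω : Set ℂ} (hu : SubharmonicOn u Ω)
    {z : ℂ} (hz : z ∈ Ω) :
    ∃ R > 0, volume ({x | u x = ⊥} ∩ ball z R) = 0 ∧ ∃ h : ℕ → ℂ → ℝ,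
      (∀ n, Measurable (h n)) ∧ (∀ n x, 0 ≤ h n x) ∧ (∀ n x, h n x ≤ 1) ∧
      (∀ n, ∀ c ∈ closedBall z (2 * R), ∀ r ≤ R,
        ∫ x in closedBall c r, h n x ≤ volume.real (closedBall c r) * h n c) ∧
      (∀ n, ∀ x ∈ closedBall z R, u x = ⊥ → ∀ᶠ y in nhds x, h n y = 1) ∧
      Tendsto (fun n => ∫ x in closedBall z (2 * R), h n x) atTop (nhds 0) := by
  obtain ⟨r, hr, M, hsub, hM⟩ := hu.exists_ball_lt hz
  obtain ⟨s, hs, hnull⟩ := hu.exists_volume_inter_ball_eq_zero hz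
  set B := ball z r with hBdef
  have huc := hu.2.1.mono hsub
  have hsm := hu.2.2.2.2.mono hsub
  set R := min r s / 4 with hR
  have hmr : min r s ≤ r := min_le_left _ _
  have hms : min r s ≤ s := min_le_right _ _
  have hm0 : 0 < min r s := lt_min hr hs
  have hRpos : 0 < R := by positivity
  have hcont := fun n : ℕ => lowerSemicontinuous_truncation (N := (n : ℝ) + 1)
    (by positivity) isOpen_ball huc hM
  refine ⟨R, hRpos, measure_mono_null (inter_subset_inter_right _ (ball_subset_ball
    (by linarith))) hnull, fun n => truncation u B M (n + 1), fun n => (hcont n).measurable,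
    fun n => truncation_nonneg (by positivity) hM, fun n => truncation_le_one (by positivity) hM,
    ?_, ?_, ?_⟩
  · intro n c hc t ht
    refine setIntegral_truncation_le (by positivity) isOpen_ball huc hM hsm ?_
    rw [mem_closedBall] at hc
    exact closedBall_subset_ball' (by linarith)
  · intro n x hx hux
    have hxB : x ∈ B := closedBall_subset_ball (by linarith) hx
    have h1 := huc x hxB ((M - (n + 1) : ℝ) : EReal) (by simpa only [hux] using EReal.bot_lt_coe _)
    rw [isOpen_ball.nhdsWithin_eq hxB] at h1
    filter_upwards [h1, isOpen_ball.mem_nhds hxB] with y hy hyB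
    exact truncation_eq_one (by positivity) hM hyB hy.le
  · have h0 : ∫ x in closedBall z (2 * R), (0 : ℝ) = 0 := by simp
    rw [← h0]
    refine tendsto_integral_of_dominated_convergence (fun _ => (1 : ℝ))
      (fun n => (hcont n).measurable.aestronglyMeasurable) ?_ (fun n => ae_of_all _ fun x => ?_) ?_
    · exact integrableOn_const (isCompact_closedBall _ _).measure_lt_top.ne
    · rw [Real.norm_of_nonneg (truncation_nonneg (by positivity) hM x)]
      exact truncation_le_one (by positivity) hM x
    · rw [ae_restrict_iff' measurableSet_closedBall]
      have : ∀ᵐ x ∂(volume : Measure ℂ), x ∉ {x | u x = ⊥} ∩ ball z s :=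
        measure_eq_zero_iff_ae_notMem.1 hnull
      filter_upwards [this] with x hx hxR
      refine tendsto_truncation hM fun _ hb => hx ⟨hb, ?_⟩
      exact closedBall_subset_ball (by linarith) hxR

theorem integrable_prod_restrict_closedBall {F : ℂ × ℂ → ℝ} (hF : Measurable F) {C : ℝ}
    (hC : ∀ p, ‖F p‖ ≤ C) {z : ℂ} {r ε : ℝ}
    (h0 : ∀ x t, t ∈ closedBall (0 : ℂ) ε → x ∉ closedBall z r → F (x, t) = 0) :
    Integrable F ((volume : Measure ℂ).prod (volume.restrict (closedBall (0 : ℂ) ε))) := by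
  have hprod : (volume : Measure ℂ).prod (volume.restrict (closedBall (0 : ℂ) ε))
      = ((volume : Measure ℂ).prod volume).restrict (univ ×ˢ closedBall (0 : ℂ) ε) := by
    rw [← Measure.prod_restrict, Measure.restrict_univ]
  rw [hprod]
  refine IntegrableOn.of_forall_sdiff_eq_zero (s := closedBall z r ×ˢ closedBall (0 : ℂ) ε)
    (Measure.integrableOn_of_bounded ?_ hF.aestronglyMeasurable (M := C) (ae_of_all _ hC))
    (MeasurableSet.univ.prod measurableSet_closedBall) ?_
  · rw [Measure.prod_prod]
    exact ENNReal.mul_ne_top (isCompact_closedBall _ _).measure_lt_top.ne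
      (isCompact_closedBall _ _).measure_lt_top.ne
  · rintro ⟨x, t⟩ ⟨⟨-, ht⟩, hx⟩
    exact h0 x t ht fun hx' => hx ⟨hx', ht⟩

theorem integrableOn_of_mem_Icc {h : ℂ → ℝ} (hm : Measurable h) {a b : ℝ}
    (hab : ∀ x, h x ∈ Icc a b) (c : ℂ) (r : ℝ) : IntegrableOn h (closedBall c r) :=
  Measure.integrableOn_of_bounded (isCompact_closedBall c r).measure_lt_top.ne
    hm.aestronglyMeasurable (M := max |a| |b|) (ae_of_all _ fun x => by
      rw [Real.norm_eq_abs]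
      exact abs_le_max_abs_abs (hab x).1 (hab x).2)

theorem setIntegral_closedBall_translate (h : ℂ → ℝ) (x : ℂ) (ε : ℝ) :
    ∫ t in closedBall (0 : ℂ) ε, h (x + t) = ∫ y in closedBall x ε, h y := by
  have := (measurePreserving_add_left volume x).setIntegral_preimage_emb
    (measurableEmbedding_addLeft x) h (closedBall x ε)
  rw [← this]
  congr 2
  ext t; simp

theorem volume_real_closedBall (x : ℂ) {ε : ℝ} (hε : 0 ≤ ε) :
    volume.real (closedBall x ε) = ε ^ 2 * Real.pi := by
  simp [Measure.real, Complex.volume_closedBall, hε]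

/-- Nonlocal Caccioppoli estimate for `[0,1]`-valued functions with a super-mean property. -/
theorem integral_bump_mul_energy_le {h : ℂ → ℝ} (hm : Measurable h) (h0 : ∀ x, 0 ≤ h x)
    (h1 : ∀ x, h x ≤ 1) {z : ℂ} {R ε : ℝ} (hR : 0 < R) (hε : 0 < ε)
    (hsm : ∀ c ∈ closedBall z R,
      ∫ x in closedBall c ε, h x ≤ volume.real (closedBall c ε) * h c) :
    ∫ x, max 0 (R ^ 2 - ‖x - z‖ ^ 2) * ∫ t in closedBall (0 : ℂ) ε, (h (x + t) - h x) ^ 2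
      ≤ 2 * ε ^ 2 * (ε ^ 2 * Real.pi) * ∫ x in closedBall z R, h x := by
  set T := closedBall (0 : ℂ) ε with hT
  set m := ε ^ 2 * Real.pi with hmdef
  have hTm : volume.real T = m := volume_real_closedBall 0 hε.le
  set η : ℂ → ℝ := fun x => max 0 (R ^ 2 - ‖x - z‖ ^ 2) with hη
  set q : ℂ → ℝ := fun x => h x ^ 2 - 2 * h x with hq
  have hqm : Measurable q := by fun_prop
  have hηm : Measurable η := by fun_prop
  have hη0 : ∀ x, 0 ≤ η x := fun x => le_max_left _ _
  have hηR : ∀ x, η x ≤ R ^ 2 := fun x => max_le (by positivity) (by nlinarith [sq_nonneg ‖x - z‖])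
  have hηout : ∀ x, x ∉ closedBall z R → η x = 0 := fun x hx => by
    rw [mem_closedBall, dist_eq_norm, not_le] at hx
    exact max_eq_left (by nlinarith)
  have hq0 : ∀ x, q x ≤ 0 := fun x => by simp only [hq]; nlinarith [h0 x, h1 x]
  have hqn : ∀ x, -q x ≤ 2 * h x := fun x => by simp only [hq]; nlinarith [h0 x, h1 x]
  have hq1 : ∀ x, |q x| ≤ 1 := fun x => abs_le.2 ⟨by simp only [hq]; nlinarith [h0 x, h1 x],
    (hq0 x).trans zero_le_one⟩
  have hFin : volume T ≠ ⊤ := (isCompact_closedBall _ _).measure_lt_top.ne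
  have hbi : ∀ (g : ℂ → ℝ), Measurable g → ∀ C, (∀ x, |g x| ≤ C) → IntegrableOn g T :=
    fun g hg C hC => Measure.integrableOn_of_bounded hFin hg.aestronglyMeasurable
      (ae_of_all _ hC)
  -- pointwise estimate of the energy density
  have hpt : ∀ x ∈ closedBall z R,
      ∫ t in T, (h (x + t) - h x) ^ 2 ≤ ∫ t in T, (q (x + t) - q x) := by
    intro x hx
    have e : ∀ t, (h (x + t) - h x) ^ 2
        = (q (x + t) - q x) + 2 * (1 - h x) * (h (x + t) - h x) := fun t => by
      simp only [hq]; ring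
    have i1 : IntegrableOn (fun t => q (x + t) - q x) T := hbi _ (by fun_prop) 2 fun t => by
      have := hq1 (x + t); have := hq1 x
      exact (abs_sub _ _).trans (by linarith)
    have i2 : IntegrableOn (fun t => h (x + t)) T := hbi _ (by fun_prop) 1 fun t => by
      rw [abs_of_nonneg (h0 _)]; exact h1 _
    have i3 : IntegrableOn (fun _ : ℂ => h x) T := integrableOn_const hFin
    have i23 : IntegrableOn (fun t => 2 * (1 - h x) * (h (x + t) - h x)) T :=
      (i2.sub i3).const_mul _
    simp_rw [e]
    rw [integral_add i1 i23, integral_const_mul, integral_sub i2 i3,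
      setIntegral_closedBall_translate, setIntegral_const, hTm, smul_eq_mul]
    have := hsm x hx
    rw [volume_real_closedBall x hε.le] at this
    nlinarith [h1 x]
  -- integrability on the product
  have I1 : Integrable (fun p : ℂ × ℂ => η p.1 * q (p.1 + p.2))
      ((volume : Measure ℂ).prod (volume.restrict T)) := by
    refine integrable_prod_restrict_closedBall (C := R ^ 2 * 1) (z := z) (r := R)
      (by fun_prop) (fun p => ?_) fun x t _ hx => by simp [hηout x hx]
    rw [norm_mul, Real.norm_of_nonneg (hη0 _)]
    exact mul_le_mul (hηR _) (hq1 _) (norm_nonneg _) (by positivity)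
  have I2 : Integrable (fun p : ℂ × ℂ => η p.1 * q p.1)
      ((volume : Measure ℂ).prod (volume.restrict T)) := by
    refine integrable_prod_restrict_closedBall (C := R ^ 2 * 1) (z := z) (r := R)
      (by fun_prop) (fun p => ?_) fun x t _ hx => by simp [hηout x hx]
    rw [norm_mul, Real.norm_of_nonneg (hη0 _)]
    exact mul_le_mul (hηR _) (hq1 _) (norm_nonneg _) (by positivity)
  have I3 : Integrable (fun p : ℂ × ℂ => η (p.1 - p.2) * q p.1)
      ((volume : Measure ℂ).prod (volume.restrict T)) := by
    refine integrable_prod_restrict_closedBall (C := R ^ 2 * 1) (z := z) (r := R + ε)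
      (by fun_prop) (fun p => ?_) fun x t ht hx => ?_
    · rw [norm_mul, Real.norm_of_nonneg (hη0 _)]
      exact mul_le_mul (hηR _) (hq1 _) (norm_nonneg _) (by positivity)
    · have : x - t ∉ closedBall z R := fun h => hx <| by
        rw [mem_closedBall_zero_iff] at ht
        rw [mem_closedBall, dist_eq_norm] at h ⊢
        calc ‖x - z‖ = ‖(x - t - z) + t‖ := by congr 1; ring
          _ ≤ _ := (norm_add_le _ _).trans (add_le_add h ht)
      simp [hηout _ this]
  have I4 : Integrable (fun p : ℂ × ℂ => η p.1 * (h (p.1 + p.2) - h p.1) ^ 2)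
      ((volume : Measure ℂ).prod (volume.restrict T)) := by
    refine integrable_prod_restrict_closedBall (C := R ^ 2 * 1) (z := z) (r := R)
      (by fun_prop) (fun p => ?_) fun x t _ hx => by simp [hηout x hx]
    rw [norm_mul, Real.norm_of_nonneg (hη0 _), Real.norm_of_nonneg (sq_nonneg _)]
    refine mul_le_mul (hηR _) ?_ (sq_nonneg _) (by positivity)
    rw [sq_le_one_iff_abs_le_one, abs_le]
    constructor <;> linarith [h0 p.1, h1 p.1, h0 (p.1 + p.2), h1 (p.1 + p.2)]
  have I12 : Integrable (fun p : ℂ × ℂ => η p.1 * q (p.1 + p.2) - η p.1 * q p.1)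
      ((volume : Measure ℂ).prod (volume.restrict T)) := I1.sub I2
  have I32 : Integrable (fun p : ℂ × ℂ => η (p.1 - p.2) * q p.1 - η p.1 * q p.1)
      ((volume : Measure ℂ).prod (volume.restrict T)) := I3.sub I2
  -- moving the difference onto the weight
  have hmean : ∀ x, (∫ t in T, (η (x - t) - η x)) * q x
      ≤ (closedBall z R).indicator (fun x => 2 * ε ^ 2 * m * h x) x := by
    intro x
    have hbη : ∀ y, |η y| ≤ R ^ 2 := fun y => by rw [abs_of_nonneg (hη0 y)]; exact hηR y
    have j1 : IntegrableOn (fun t => η (x - t)) T := hbi _ (by fun_prop) _ fun t => hbη _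
    have j2 : IntegrableOn (fun t => η (x + t)) T := hbi _ (by fun_prop) _ fun t => hbη _
    have j3 : IntegrableOn (fun _ : ℂ => η x) T := integrableOn_const hFin
    have j12 : IntegrableOn (fun t => η (x - t) + η (x + t)) T := j1.add j2
    have hsym : ∫ t in T, η (x - t) = ∫ t in T, η (x + t) := by
      have := (Measure.measurePreserving_neg (volume : Measure ℂ)).setIntegral_preimage_emb
        (MeasurableEquiv.neg ℂ).measurableEmbedding (fun t => η (x + t)) T
      rw [← this]
      have hpre : Neg.neg ⁻¹' T = T := by ext t; simp [hT]
      rw [hpre]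
      simp [sub_eq_add_neg]
    have hpar : ∀ t, ‖x - t - z‖ ^ 2 + ‖x + t - z‖ ^ 2 = 2 * (‖x - z‖ ^ 2 + ‖t‖ ^ 2) := by
      intro t
      have := parallelogram_law_with_norm ℝ (x - z) t
      rw [show x - t - z = x - z - t by ring, show x + t - z = x - z + t by ring]
      nlinarith
    by_cases hx : x ∈ closedBall z R
    · rw [indicator_of_mem hx]
      have hηx : η x = R ^ 2 - ‖x - z‖ ^ 2 := by
        rw [mem_closedBall, dist_eq_norm] at hx
        exact max_eq_right (by nlinarith [norm_nonneg (x - z)])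
      have hlow : -(ε ^ 2 * m) ≤ ∫ t in T, (η (x - t) - η x) := by
        have hle : ∫ t in T, (-(2 * ε ^ 2)) ≤ ∫ t in T, (η (x - t) + η (x + t) - 2 * η x) := by
          refine setIntegral_mono_on (integrableOn_const hFin) (j12.sub
            (j3.const_mul 2)) measurableSet_closedBall fun t ht => ?_
          have a1 : R ^ 2 - ‖x - t - z‖ ^ 2 ≤ η (x - t) := le_max_right _ _
          have a2 : R ^ 2 - ‖x + t - z‖ ^ 2 ≤ η (x + t) := le_max_right _ _
          rw [hT, mem_closedBall_zero_iff] at ht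
          have : ‖t‖ ^ 2 ≤ ε ^ 2 := by gcongr
          linarith [hpar t]
        rw [setIntegral_const, hTm, integral_sub j12 (j3.const_mul 2),
          integral_add j1 j2, integral_const_mul, ← hsym, smul_eq_mul] at hle
        rw [integral_sub j1 j3]
        linarith
      have := hqn x
      have hm0 : 0 ≤ ε ^ 2 * m := by positivity
      nlinarith [hq0 x]
    · rw [indicator_of_notMem hx]
      refine mul_nonpos_of_nonneg_of_nonpos (integral_nonneg fun t => ?_) (hq0 x)
      simpa [hηout x hx] using hη0 _
  calc ∫ x, η x * ∫ t in T, (h (x + t) - h x) ^ 2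
      ≤ ∫ x, η x * ∫ t in T, (q (x + t) - q x) := by
        refine integral_mono ?_ ?_ fun x => ?_
        · simpa only [integral_const_mul] using I4.integral_prod_left
        · simpa only [integral_const_mul, ← mul_sub] using I12.integral_prod_left
        · by_cases hx : x ∈ closedBall z R
          · exact mul_le_mul_of_nonneg_left (hpt x hx) (hη0 x)
          · simp [hηout x hx]
    _ = ∫ x, ∫ t in T, (η x * q (x + t) - η x * q x) := by
        simp_rw [← mul_sub, integral_const_mul]
    _ = ∫ x, ∫ t in T, (η (x - t) * q x - η x * q x) := by
        rw [integral_integral_swap (f := fun x t => η x * q (x + t) - η x * q x) I12,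
          integral_integral_swap (f := fun x t => η (x - t) * q x - η x * q x) I32]
        refine integral_congr_ae ?_
        filter_upwards [I1.prod_left_ae, I2.prod_left_ae, I3.prod_left_ae] with t k1 k2 k3
        rw [integral_sub k1 k2, integral_sub k3 k2]
        congr 1
        rw [← integral_add_right_eq_self (fun x => η (x - t) * q x) t]
        simp
    _ = ∫ x, (∫ t in T, (η (x - t) - η x)) * q x := by
        simp_rw [← sub_mul, integral_mul_const]
    _ ≤ ∫ x, (closedBall z R).indicator (fun x => 2 * ε ^ 2 * m * h x) x := by
        refine integral_mono ?_ ?_ hmean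
        · simpa only [integral_mul_const, ← sub_mul] using I32.integral_prod_left
        · rw [integrable_indicator_iff measurableSet_closedBall]
          exact (integrableOn_of_mem_Icc hm (fun x => ⟨h0 x, h1 x⟩) _ _).const_mul _
    _ = _ := by rw [integral_indicator measurableSet_closedBall, integral_const_mul]

theorem exists_mollifier : ∃ C > 0, ∀ ε > 0, ∃ g : ℂ → ℝ, ContDiff ℝ 1 g ∧
    (∀ t, 0 ≤ g t) ∧ (∀ t, g t ≤ C * ε⁻¹ ^ 2) ∧ (∀ t ∉ closedBall (0 : ℂ) ε, g t = 0) ∧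
    (∀ t ∉ closedBall (0 : ℂ) ε, fderiv ℝ g t = 0) ∧
    (∀ t, ‖fderiv ℝ g t‖ ≤ C * ε⁻¹ ^ 3) ∧ ∫ t, g t = 1 := by
  set b : ContDiffBump (0 : ℂ) := ⟨1 / 2, 1, by norm_num, by norm_num⟩ with hb
  set φ : ℂ → ℝ := b.normed volume with hφ
  have hφc : ContDiff ℝ 1 φ := b.contDiff_normed
  have hφs : HasCompactSupport φ := b.hasCompactSupport_normed
  have hφt : tsupport φ = closedBall 0 1 := b.tsupport_normed_eq
  obtain ⟨C₁, hC₁⟩ := hφs.exists_bound_of_continuous hφc.continuous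
  obtain ⟨C₂, hC₂⟩ := (hφs.fderiv ℝ).exists_bound_of_continuous (hφc.continuous_fderiv one_ne_zero)
  refine ⟨max 1 (max C₁ C₂), by positivity, fun ε hε => ?_⟩
  have hd : ∀ t, HasFDerivAt (fun t : ℂ => ε⁻¹ ^ 2 * φ (ε⁻¹ • t))
      (ε⁻¹ ^ 2 • ε⁻¹ • fderiv ℝ φ (ε⁻¹ • t)) t := fun t => by
    have h1 : HasFDerivAt φ (fderiv ℝ φ (ε⁻¹ • t)) (ε⁻¹ • t) :=
      (hφc.differentiable one_ne_zero _).hasFDerivAt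
    have h2 : HasFDerivAt (fun t : ℂ => ε⁻¹ • t) (ε⁻¹ • ContinuousLinearMap.id ℝ ℂ) t :=
      (hasFDerivAt_id t).const_smul ε⁻¹
    have h3 := (h1.comp t h2).const_mul (ε⁻¹ ^ 2)
    have he : ε⁻¹ ^ 2 • ε⁻¹ • fderiv ℝ φ (ε⁻¹ • t) = ε⁻¹ ^ 2 •
        (fderiv ℝ φ (ε⁻¹ • t)).comp (ε⁻¹ • ContinuousLinearMap.id ℝ ℂ) := by
      rw [ContinuousLinearMap.comp_smul, ContinuousLinearMap.comp_id]
    rw [he]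
    exact h3
  have hout : ∀ t ∉ closedBall (0 : ℂ) ε, ε⁻¹ • t ∉ tsupport φ := fun t ht => by
    rw [hφt]
    rw [mem_closedBall_zero_iff, not_le] at ht ⊢
    rw [norm_smul, Real.norm_of_nonneg (by positivity), ← div_eq_inv_mul, lt_div_iff₀ hε, one_mul]
    exact ht
  refine ⟨fun t => ε⁻¹ ^ 2 * φ (ε⁻¹ • t), by fun_prop, fun t => ?_, fun t => ?_, fun t ht => ?_,
    fun t ht => ?_, fun t => ?_, ?_⟩
  · have : 0 ≤ φ (ε⁻¹ • t) := b.nonneg_normed _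
    positivity
  · refine (mul_comm _ _).trans_le (mul_le_mul_of_nonneg_right ?_ (by positivity))
    exact (le_abs_self _).trans ((hC₁ _).trans ((le_max_left _ _).trans (le_max_right _ _)))
  · simp only [image_eq_zero_of_notMem_tsupport (hout t ht), mul_zero]
  · rw [(hd t).fderiv, image_eq_zero_of_notMem_tsupport
      (fun h => hout t ht (tsupport_fderiv_subset ℝ h)), smul_zero, smul_zero]
  · rw [(hd t).fderiv, norm_smul, norm_smul, Real.norm_of_nonneg (by positivity),
      Real.norm_of_nonneg (by positivity)]
    have := (hC₂ (ε⁻¹ • t)).trans ((le_max_right C₁ _).trans (le_max_right 1 _))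
    calc _ = ε⁻¹ ^ 3 * ‖fderiv ℝ φ (ε⁻¹ • t)‖ := by ring
      _ ≤ ε⁻¹ ^ 3 * max 1 (max C₁ C₂) := by gcongr
      _ = _ := mul_comm _ _
  · rw [integral_const_mul, Measure.integral_comp_inv_smul, b.integral_normed]
    simp [Complex.finrank_real_complex, hε.ne']

theorem sq_integral_le_mul_integral_sq {α : Type*} [MeasurableSpace α] {μ : Measure α}
    [IsFiniteMeasure μ] {a : α → ℝ} (ha : Integrable a μ) (ha2 : Integrable (fun x => a x ^ 2) μ) :
    (∫ x, a x ∂μ) ^ 2 ≤ μ.real univ * ∫ x, a x ^ 2 ∂μ := by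
  set S := ∫ x, a x ∂μ with hS
  set m := μ.real univ with hm
  rcases eq_or_lt_of_le (measureReal_nonneg (μ := μ) (s := univ)) with h | h
  · have : μ = 0 := by
      rw [← Measure.measure_univ_eq_zero]
      exact (measureReal_eq_zero_iff).1 h.symm
    simp [hS, hm, this]
  · have h0 : 0 ≤ ∫ x, (m * a x - S) ^ 2 ∂μ := integral_nonneg fun _ => sq_nonneg _
    have e : ∀ x, (m * a x - S) ^ 2 = m ^ 2 * a x ^ 2 - 2 * m * S * a x + S ^ 2 := fun x => by ring
    have i1 : Integrable (fun x => m ^ 2 * a x ^ 2 - 2 * m * S * a x) μ :=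
      (ha2.const_mul _).sub (ha.const_mul _)
    simp_rw [e] at h0
    rw [integral_add i1 (integrable_const _), integral_sub (ha2.const_mul _) (ha.const_mul _),
      integral_const_mul, integral_const_mul, integral_const, smul_eq_mul, ← hm, ← hS] at h0
    have : 0 ≤ m * (m * ∫ x, a x ^ 2 ∂μ - S ^ 2) := by
      rw [mul_sub]; rw [← hS] at *; nlinarith
    have := nonneg_of_mul_nonneg_right this h
    linarith

open scoped Convolution in
theorem hasFDerivAt_integral_mul_translate {k g : ℂ → ℝ} (hk : LocallyIntegrable k)
    (hg : ContDiff ℝ 1 g) (hgs : HasCompactSupport g) (x : ℂ) :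
    HasFDerivAt (fun x => ∫ t, k t * g (x - t)) (∫ t, k t • fderiv ℝ g (x - t)) x :=
  hgs.hasFDerivAt_convolution_right (ContinuousLinearMap.lsmul ℝ ℝ) hk hg x

theorem contDiff_integral_mul_translate {k g : ℂ → ℝ} (hk : LocallyIntegrable k)
    (hg : ContDiff ℝ 1 g) (hgs : HasCompactSupport g) :
    ContDiff ℝ 1 (fun x => ∫ t, k t * g (x - t)) :=
  hgs.contDiff_convolution_right (ContinuousLinearMap.lsmul ℝ ℝ) hk hg

/-- Mollification of a `[0,1]`-valued function with a super-mean property. -/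
theorem exists_mollification : ∃ C > 0, ∀ ε > 0, ∀ h : ℂ → ℝ, Measurable h →
    (∀ x, 0 ≤ h x) → (∀ x, h x ≤ 1) → ∃ χ : ℂ → ℝ, ContDiff ℝ 1 χ ∧
    (∀ x, (∀ y ∈ closedBall x ε, h y = 1) → χ x = 1) ∧
    (∀ x, ∫ y in closedBall x ε, h y ≤ volume.real (closedBall x ε) * h x →
      χ x ^ 2 ≤ C * h x) ∧
    (∀ x, ‖fderiv ℝ χ x‖ ^ 2 ≤ C * ε⁻¹ ^ 4 * ∫ t in closedBall (0 : ℂ) ε, (h (x + t) - h x) ^ 2) := by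
  obtain ⟨C, hC, key⟩ := exists_mollifier
  refine ⟨C ^ 2 * Real.pi ^ 2 + C ^ 2 * Real.pi, by positivity, fun ε hε h hm h0 h1 => ?_⟩
  obtain ⟨g, hg, hg0, hgC, hgout, hDout, hDC, hg1⟩ := key ε hε
  have hgs : HasCompactSupport g := HasCompactSupport.intro (isCompact_closedBall 0 ε) hgout
  have hFin : volume (closedBall (0 : ℂ) ε) ≠ ⊤ := (isCompact_closedBall _ _).measure_lt_top.ne
  have hTm : volume.real (closedBall (0 : ℂ) ε) = ε ^ 2 * Real.pi := volume_real_closedBall 0 hε.le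
  have hloc : ∀ k : ℂ → ℝ, Measurable k → (∀ x, |k x| ≤ 1) → LocallyIntegrable k := fun k hk hb =>
    (locallyIntegrable_const (1 : ℝ)).mono hk.aestronglyMeasurable
      (ae_of_all _ fun x => by simpa using hb x)
  have hgx : ∀ x, ∫ t, g (x - t) = 1 := fun x => by rw [integral_sub_left_eq_self, hg1]
  have hgi : ∀ x, Integrable (fun t => g (x - t)) := fun x =>
    (hg.continuous.integrable_of_hasCompactSupport hgs).comp_sub_left x
  have hhg : ∀ x, Integrable (fun t => h t * g (x - t)) := fun x =>
    (hgi x).bdd_mul hm.aestronglyMeasurable (c := 1)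
      (ae_of_all _ fun t => by rw [Real.norm_of_nonneg (h0 t)]; exact h1 t)
  have hnn : ∀ t : ℂ, t ∉ closedBall (0 : ℂ) ε → -t ∉ closedBall (0 : ℂ) ε := fun t ht => by
    simpa using ht
  refine ⟨fun x => ∫ t, h t * g (x - t), contDiff_integral_mul_translate
    (hloc h hm fun x => by rw [abs_of_nonneg (h0 x)]; exact h1 x) hg hgs,
    fun x hx => ?_, fun x hx => ?_, fun x => ?_⟩
  · rw [← hgx x]
    refine integral_congr_ae (ae_of_all _ fun t => ?_)
    by_cases ht : t ∈ closedBall x ε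
    · simp [hx t ht]
    · have : x - t ∉ closedBall (0 : ℂ) ε := by
        rwa [mem_closedBall_zero_iff, ← dist_eq_norm, dist_comm]
      simp [hgout _ this]
  · have hnonneg : 0 ≤ ∫ t, h t * g (x - t) := integral_nonneg fun t => mul_nonneg (h0 t) (hg0 _)
    have hle : ∫ t, h t * g (x - t) ≤ C * Real.pi * h x := by
      calc ∫ t, h t * g (x - t) = ∫ t in closedBall x ε, h t * g (x - t) := by
            refine (setIntegral_eq_integral_of_forall_compl_eq_zero fun t ht => ?_).symm
            have : x - t ∉ closedBall (0 : ℂ) ε := by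
              rwa [mem_closedBall_zero_iff, ← dist_eq_norm, dist_comm]
            simp [hgout _ this]
        _ ≤ ∫ t in closedBall x ε, h t * (C * ε⁻¹ ^ 2) :=
            integral_mono (hhg x).integrableOn
              ((integrableOn_of_mem_Icc hm (fun x => ⟨h0 x, h1 x⟩) _ _).mul_const _)
              fun t => mul_le_mul_of_nonneg_left (hgC _) (h0 t)
        _ = (∫ t in closedBall x ε, h t) * (C * ε⁻¹ ^ 2) := integral_mul_const _ _
        _ ≤ volume.real (closedBall x ε) * h x * (C * ε⁻¹ ^ 2) := by gcongr
        _ = C * Real.pi * h x := by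
            rw [volume_real_closedBall x hε.le]; field_simp
    calc (∫ t, h t * g (x - t)) ^ 2 ≤ (C * Real.pi * h x) ^ 2 := by gcongr
      _ = C ^ 2 * Real.pi ^ 2 * (h x * h x) := by ring
      _ ≤ (C ^ 2 * Real.pi ^ 2 + C ^ 2 * Real.pi) * (h x * 1) := by
          gcongr
          · exact mul_nonneg (h0 x) (h0 x)
          · linarith [show 0 ≤ C ^ 2 * Real.pi by positivity]
          · exact h0 x
          · exact h1 x
      _ = _ := by rw [mul_one]
  · set k : ℂ → ℝ := fun t => h t - h x with hk
    have hkm : Measurable k := by fun_prop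
    have hk1 : ∀ t, |k t| ≤ 1 := fun t => by
      rw [abs_le]; constructor <;> linarith [h0 t, h0 x, h1 t, h1 x]
    have hD := hasFDerivAt_integral_mul_translate (hloc k hkm hk1) hg hgs x
    have he : (fun y => ∫ t, h t * g (y - t)) = fun y => (∫ t, k t * g (y - t)) + h x := by
      funext y
      simp only [hk, sub_mul]
      rw [integral_sub (hhg y) ((hgi y).const_mul _), integral_const_mul, hgx]
      ring
    rw [he, (hD.add_const (h x)).fderiv]
    have hka : Measurable fun t => |k (x + t)| :=
      (hkm.comp (measurable_const_add x)).abs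
    have hki : IntegrableOn (fun t => |k (x + t)|) (closedBall 0 ε) :=
      Measure.integrableOn_of_bounded hFin hka.aestronglyMeasurable (M := 1)
        (ae_of_all _ fun t => by simpa using hk1 _)
    have hki2 : IntegrableOn (fun t => |k (x + t)| ^ 2) (closedBall 0 ε) :=
      Measure.integrableOn_of_bounded hFin (hka.pow_const 2).aestronglyMeasurable (M := 1)
        (ae_of_all _ fun t => by simpa using hk1 _)
    have hbd : ‖∫ t, k t • fderiv ℝ g (x - t)‖
        ≤ C * ε⁻¹ ^ 3 * ∫ t in closedBall (0 : ℂ) ε, |k (x + t)| := by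
      calc ‖∫ t, k t • fderiv ℝ g (x - t)‖ ≤ ∫ t, ‖k t • fderiv ℝ g (x - t)‖ :=
            norm_integral_le_integral_norm _
        _ = ∫ t, ‖k (x + t) • fderiv ℝ g (x - (x + t))‖ :=
            (integral_add_left_eq_self (fun t => ‖k t • fderiv ℝ g (x - t)‖) x).symm
        _ = ∫ t in closedBall (0 : ℂ) ε, ‖k (x + t) • fderiv ℝ g (x - (x + t))‖ := by
            refine (setIntegral_eq_integral_of_forall_compl_eq_zero fun t ht => ?_).symm
            rw [sub_add_cancel_left, hDout _ (hnn t ht), smul_zero, norm_zero]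
        _ ≤ ∫ t in closedBall (0 : ℂ) ε, C * ε⁻¹ ^ 3 * |k (x + t)| := by
            refine integral_mono_of_nonneg (ae_of_all _ fun _ => norm_nonneg _)
              (hki.const_mul _) (ae_of_all _ fun t => ?_)
            simp only [norm_smul, Real.norm_eq_abs]
            rw [mul_comm]
            exact mul_le_mul_of_nonneg_right (hDC _) (abs_nonneg _)
        _ = _ := integral_const_mul _ _
    have : IsFiniteMeasure (volume.restrict (closedBall (0 : ℂ) ε)) :=
      isFiniteMeasure_restrict.2 hFin
    have hcs := sq_integral_le_mul_integral_sq hki hki2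
    rw [measureReal_restrict_apply_univ, hTm] at hcs
    simp only [sq_abs] at hcs
    calc ‖∫ t, k t • fderiv ℝ g (x - t)‖ ^ 2
        ≤ (C * ε⁻¹ ^ 3 * ∫ t in closedBall (0 : ℂ) ε, |k (x + t)|) ^ 2 := by gcongr
      _ = (C * ε⁻¹ ^ 3) ^ 2 * (∫ t in closedBall (0 : ℂ) ε, |k (x + t)|) ^ 2 := by ring
      _ ≤ (C * ε⁻¹ ^ 3) ^ 2 * (ε ^ 2 * Real.pi * ∫ t in closedBall (0 : ℂ) ε, k (x + t) ^ 2) := by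
          gcongr
      _ = C ^ 2 * Real.pi * ε⁻¹ ^ 4 * ∫ t in closedBall (0 : ℂ) ε, k (x + t) ^ 2 := by
          field_simp
      _ ≤ _ := by
          have : 0 ≤ ∫ t in closedBall (0 : ℂ) ε, k (x + t) ^ 2 :=
            integral_nonneg fun _ => sq_nonneg _
          gcongr
          linarith [show 0 ≤ C ^ 2 * Real.pi ^ 2 by positivity]

/-- Smooth cutoffs of small `W^{1,2}`-norm that are `1` near compact subsets of a polar set. -/
theorem SubharmonicOn.exists_cutoffs {u : ℂ → EReal} {Ω : Set ℂ} (hu : SubharmonicOn u Ω)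
    {z : ℂ} (hz : z ∈ Ω) :
    ∃ R > 0, volume ({x | u x = ⊥} ∩ ball z R) = 0 ∧ ∀ K : Set ℂ, IsCompact K →
      K ⊆ closedBall z R → (∀ x ∈ K, u x = ⊥) → ∀ δ > 0, ∃ χ : ℂ → ℝ, ContDiff ℝ 1 χ ∧
        (∀ x ∈ K, ∀ᶠ y in nhds x, χ y = 1) ∧
        ∫ x in closedBall z R, (χ x ^ 2 + ‖fderiv ℝ χ x‖ ^ 2) ≤ δ := by
  obtain ⟨R, hR, hvol, h, hm, h0, h1, hsm, heq, hlim⟩ := hu.exists_truncations hz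
  obtain ⟨C, hC, hmoll⟩ := exists_mollification
  refine ⟨R, hR, hvol, fun K hK hKR hKu δ hδ => ?_⟩
  set A : ℝ := C * (1 + 2 * Real.pi / (3 * R ^ 2)) with hA
  have hA0 : 0 < A := by positivity
  obtain ⟨n, hn⟩ := (hlim.eventually (gt_mem_nhds (show (0 : ℝ) < δ / A by positivity))).exists
  set H := ∫ x in closedBall z (2 * R), h n x with hH
  have hKint : K ⊆ interior {y | h n y = 1} := fun x hx =>
    mem_interior_iff_mem_nhds.2 (heq n x (hKR hx) (hKu x hx))
  obtain ⟨ε₀, hε₀, hthick⟩ := hK.exists_cthickening_subset_open isOpen_interior hKint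
  set ε := min (ε₀ / 2) R with hεdef
  have hε : 0 < ε := by positivity
  have hFin : ∀ (c : ℂ) (r : ℝ), volume (closedBall c r) ≠ ⊤ := fun c r =>
    (isCompact_closedBall _ _).measure_lt_top.ne
  obtain ⟨χ, hχ, hχ1, hχ2, hχD⟩ := hmoll ε hε (h n) (hm n) (h0 n) (h1 n)
  refine ⟨χ, hχ, fun x hx => ?_, ?_⟩
  · filter_upwards [ball_mem_nhds x hε] with y hy
    refine hχ1 y fun w hw => ?_
    refine interior_subset (s := {y | h n y = 1})
      (hthick (mem_cthickening_of_dist_le w x ε₀ K hx ?_))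
    have := min_le_left (ε₀ / 2) R
    rw [mem_ball] at hy
    rw [mem_closedBall] at hw
    linarith [dist_triangle w y x]
  set E : ℂ → ℝ := fun x => ∫ t in closedBall (0 : ℂ) ε, (h n (x + t) - h n x) ^ 2 with hE
  have hE0 : ∀ x, 0 ≤ E x := fun x => integral_nonneg fun _ => sq_nonneg _
  have hEm : Measurable E := by
    have hmn := hm n
    have : Measurable fun p : ℂ × ℂ => (h n (p.1 + p.2) - h n p.1) ^ 2 := by fun_prop
    exact (this.stronglyMeasurable.integral_prod_right' (ν := volume.restrict _)).measurable
  have hEb : ∀ x, ‖E x‖ ≤ 1 * volume.real (closedBall (0 : ℂ) ε) := fun x => by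
    refine norm_setIntegral_le_of_norm_le_const (hFin _ _).lt_top fun t _ => ?_
    rw [Real.norm_of_nonneg (sq_nonneg _), sq_le_one_iff_abs_le_one, abs_le]
    constructor <;> linarith [h0 n x, h1 n x, h0 n (x + t), h1 n (x + t)]
  have hEi : ∀ (c : ℂ) (r : ℝ), IntegrableOn E (closedBall c r) := fun c r =>
    Measure.integrableOn_of_bounded (hFin c r) hEm.aestronglyMeasurable (ae_of_all _ hEb)
  have henergy := integral_bump_mul_energy_le (hm n) (h0 n) (h1 n)
    (show 0 < 2 * R by positivity) hε fun c hc => hsm n c hc ε (min_le_right _ _)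
  have hηE : Integrable fun x => max 0 ((2 * R) ^ 2 - ‖x - z‖ ^ 2) * E x := by
    rw [← integrableOn_univ]
    refine IntegrableOn.of_forall_sdiff_eq_zero (s := closedBall z (2 * R))
      ((hEi z (2 * R)).bdd_mul (c := (2 * R) ^ 2) (by fun_prop) (ae_of_all _ fun x => ?_))
      MeasurableSet.univ fun x hx => ?_
    · rw [Real.norm_of_nonneg (le_max_left _ _)]
      exact max_le (by positivity) (by nlinarith [sq_nonneg ‖x - z‖])
    · have hx' := hx.2
      rw [mem_closedBall, dist_eq_norm, not_le] at hx'
      rw [max_eq_left (by nlinarith), zero_mul]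
  have hEint : 3 * R ^ 2 * ∫ x in closedBall z R, E x
      ≤ 2 * ε ^ 2 * (ε ^ 2 * Real.pi) * H := by
    refine le_trans ?_ henergy
    rw [← integral_const_mul]
    refine (setIntegral_mono_on ((hEi z R).const_mul _) hηE.integrableOn
      measurableSet_closedBall fun x hx => ?_).trans (setIntegral_le_integral hηE
        (ae_of_all _ fun x => mul_nonneg (le_max_left _ _) (hE0 x)))
    refine mul_le_mul_of_nonneg_right (le_max_of_le_right ?_) (hE0 x)
    rw [mem_closedBall, dist_eq_norm] at hx
    nlinarith [norm_nonneg (x - z)]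
  have hhi : ∀ c r, IntegrableOn (h n) (closedBall c r) := fun c r =>
    integrableOn_of_mem_Icc (hm n) (fun x => ⟨h0 n x, h1 n x⟩) c r
  have hhH : ∫ x in closedBall z R, h n x ≤ H :=
    setIntegral_mono_set (hhi _ _) (ae_of_all _ (h0 n))
      (closedBall_subset_closedBall (by linarith)).eventuallyLE
  calc ∫ x in closedBall z R, (χ x ^ 2 + ‖fderiv ℝ χ x‖ ^ 2)
      ≤ ∫ x in closedBall z R, (C * h n x + C * ε⁻¹ ^ 4 * E x) := by
        refine setIntegral_mono_on ?_ (((hhi _ _).const_mul _).add ((hEi _ _).const_mul _))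
          measurableSet_closedBall fun x hx => ?_
        · have := hχ.continuous_fderiv one_ne_zero
          have := hχ.continuous
          exact (Continuous.continuousOn (by fun_prop)).integrableOn_compact
            (isCompact_closedBall z R)
        · exact add_le_add (hχ2 x (hsm n x (closedBall_subset_closedBall (by linarith) hx) ε
            (min_le_right _ _))) (hχD x)
    _ = C * (∫ x in closedBall z R, h n x) + C * ε⁻¹ ^ 4 * ∫ x in closedBall z R, E x := by
        rw [integral_add ((hhi _ _).const_mul _) ((hEi _ _).const_mul _), integral_const_mul,
          integral_const_mul]
    _ ≤ C * H + C * ε⁻¹ ^ 4 * (2 * ε ^ 2 * (ε ^ 2 * Real.pi) * H / (3 * R ^ 2)) := by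
        gcongr
        rw [le_div_iff₀ (by positivity), mul_comm]
        exact hEint
    _ = A * H := by rw [hA]; field_simp
    _ ≤ δ := by
        rw [lt_div_iff₀ hA0] at hn
        linarith

/-- The Wirtinger operator `2 ∂/∂z̄`. -/
noncomputable def dbar (g : ℂ → ℂ) (x : ℂ) : ℂ := fderiv ℝ g x 1 + Complex.I * fderiv ℝ g x Complex.I

theorem dbar_mul {f g : ℂ → ℂ} {x : ℂ} (hf : DifferentiableAt ℝ f x) (hg : DifferentiableAt ℝ g x) :
    dbar (fun y => f y * g y) x = f x * dbar g x + g x * dbar f x := by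
  simp only [dbar, fderiv_fun_mul hf hg, add_apply, smul_apply,
    smul_eq_mul]
  ring

theorem dbar_sub {f g : ℂ → ℂ} {x : ℂ} (hf : DifferentiableAt ℝ f x) (hg : DifferentiableAt ℝ g x) :
    dbar (fun y => f y - g y) x = dbar f x - dbar g x := by
  simp only [dbar, fderiv_fun_sub hf hg, sub_apply]
  ring

theorem dbar_eq_zero {f : ℂ → ℂ} {x : ℂ} (hf : DifferentiableAt ℂ f x) : dbar f x = 0 := by
  rw [dbar, hf.fderiv_restrictScalars ℝ]
  simp only [ContinuousLinearMap.coe_restrictScalars']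
  have : fderiv ℂ f x Complex.I = Complex.I * fderiv ℂ f x 1 := by
    rw [← smul_eq_mul, ← map_smul, smul_eq_mul, mul_one]
  rw [this, ← mul_assoc, Complex.I_mul_I]
  ring

theorem Filter.EventuallyEq.dbar_eq {f g : ℂ → ℂ} {x : ℂ} (h : f =ᶠ[nhds x] g) :
    dbar f x = dbar g x := by
  rw [dbar, dbar, h.fderiv_eq]

theorem dbar_const (c x : ℂ) : dbar (fun _ => c) x = 0 := dbar_eq_zero (differentiableAt_const c)

theorem ContDiff.continuous_dbar {g : ℂ → ℂ} (hg : ContDiff ℝ 1 g) : Continuous (dbar g) := by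
  have := hg.continuous_fderiv one_ne_zero
  unfold dbar
  fun_prop

theorem HasCompactSupport.dbar {g : ℂ → ℂ} (hg : HasCompactSupport g) :
    HasCompactSupport (dbar g) := by
  refine (hg.fderiv ℝ).mono' fun x hx => ?_
  rw [Function.mem_support] at hx
  refine subset_tsupport _ fun h => hx ?_
  simp [_root_.dbar, h]

theorem norm_dbar_ofReal_le {χ : ℂ → ℝ} {x : ℂ} (h : DifferentiableAt ℝ χ x) :
    ‖dbar (fun y => (χ y : ℂ)) x‖ ≤ 2 * ‖fderiv ℝ χ x‖ := by
  have h1 : HasFDerivAt (fun y => (χ y : ℂ)) (Complex.ofRealCLM.comp (fderiv ℝ χ x)) x :=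
    Complex.ofRealCLM.hasFDerivAt.comp x h.hasFDerivAt
  rw [dbar, h1.fderiv]
  refine (norm_add_le _ _).trans ?_
  rw [norm_mul, Complex.norm_I, one_mul]
  simp only [ContinuousLinearMap.comp_apply, Complex.ofRealCLM_apply, Complex.norm_real]
  have a1 := (fderiv ℝ χ x).le_opNorm 1
  have a2 := (fderiv ℝ χ x).le_opNorm Complex.I
  rw [norm_one, mul_one] at a1
  rw [Complex.norm_I, mul_one] at a2
  linarith

theorem integral_fderiv_apply_eq_zero {Φ : ℂ → ℂ} (h : ContDiff ℝ 1 Φ) (hs : HasCompactSupport Φ)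
    (v : ℂ) : ∫ x, fderiv ℝ Φ x v = 0 := by
  have hc : Continuous fun x => fderiv ℝ Φ x v := (h.continuous_fderiv one_ne_zero).clm_apply
    continuous_const
  have hi : Integrable fun x => fderiv ℝ Φ x v :=
    hc.integrable_of_hasCompactSupport (hs.fderiv_apply ℝ v)
  have := integral_mul_fderiv_eq_neg_fderiv_mul_of_integrable (𝕜 := ℂ) (μ := volume)
    (f := fun _ : ℂ => (1 : ℂ)) (g := Φ) (v := v) (by simp) (by simpa using hi)
    (by simpa using h.continuous.integrable_of_hasCompactSupport hs)
    (fun _ _ => differentiableAt_const _) fun x _ => h.differentiable one_ne_zero x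
  simpa using this

theorem integral_dbar_eq_zero {Φ : ℂ → ℂ} (h : ContDiff ℝ 1 Φ) (hs : HasCompactSupport Φ) :
    ∫ x, dbar Φ x = 0 := by
  have hi : ∀ v, Integrable fun x => fderiv ℝ Φ x v := fun v =>
    ((h.continuous_fderiv one_ne_zero).clm_apply
      continuous_const).integrable_of_hasCompactSupport (hs.fderiv_apply ℝ v)
  unfold dbar
  rw [integral_add (hi 1) ((hi _).const_mul _), integral_const_mul,
    integral_fderiv_apply_eq_zero h hs, integral_fderiv_apply_eq_zero h hs]
  simp

theorem eq_zero_of_forall_pos_le_mul {a N : ℝ} (ha : 0 ≤ a) (h : ∀ s > 0, a ≤ N * s) : a = 0 := by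
  by_contra hne
  have hpos := ha.lt_of_ne' hne
  have h1 := h (a / (2 * (|N| + 1))) (by positivity)
  have : N * (a / (2 * (|N| + 1))) ≤ (|N| + 1) * (a / (2 * (|N| + 1))) := by
    gcongr
    linarith [le_abs_self N]
  have h3 : (|N| + 1) * (a / (2 * (|N| + 1))) = a / 2 := by field_simp
  linarith

/-- Square-integrable holomorphic functions satisfy the Cauchy–Riemann equation weakly across
relatively closed sets admitting smooth cutoffs of small `W^{1,2}`-norm. -/
theorem integral_mul_dbar_eq_zero {D : Set ℂ} (hD : IsOpen D) {z : ℂ} {R : ℝ}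
    (hcut : ∀ δ > 0, ∃ χ : ℂ → ℝ, ContDiff ℝ 1 χ ∧
      (∀ x ∈ closedBall z R \ D, ∀ᶠ y in nhds x, χ y = 1) ∧
      ∫ x in closedBall z R, (χ x ^ 2 + ‖fderiv ℝ χ x‖ ^ 2) ≤ δ)
    {f : ℂ → ℂ} (hf : DifferentiableOn ℂ f (D ∩ ball z R))
    (hf2 : IntegrableOn (fun x => ‖f x‖ ^ 2) (D ∩ ball z R))
    {φ : ℂ → ℂ} (hφ : ContDiff ℝ 1 φ) (hφs : tsupport φ ⊆ ball z R) :
    ∫ x in D ∩ ball z R, f x * dbar φ x = 0 := by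
  set S := D ∩ ball z R with hSdef
  have hS : IsOpen S := hD.inter isOpen_ball
  have hSB : S ⊆ closedBall z R := inter_subset_right.trans ball_subset_closedBall
  have hSfin : volume S ≠ ⊤ :=
    ((measure_mono hSB).trans_lt (isCompact_closedBall z R).measure_lt_top).ne
  have hφcs : HasCompactSupport φ :=
    (isCompact_closedBall z R).of_isClosed_subset (isClosed_tsupport φ)
      (hφs.trans ball_subset_closedBall)
  obtain ⟨M₁, hM₁⟩ := hφcs.exists_bound_of_continuous hφ.continuous
  obtain ⟨M₂, hM₂⟩ := hφcs.dbar.exists_bound_of_continuous hφ.continuous_dbar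
  set M := max M₁ M₂ with hM
  have hMφ : ∀ x, ‖φ x‖ ≤ M := fun x => (hM₁ x).trans (le_max_left _ _)
  have hMd : ∀ x, ‖dbar φ x‖ ≤ M := fun x => (hM₂ x).trans (le_max_right _ _)
  have hM0 : 0 ≤ M := (norm_nonneg _).trans (hMφ 0)
  have hfm : AEStronglyMeasurable f (volume.restrict S) :=
    hf.continuousOn.aestronglyMeasurable hS.measurableSet
  have hfi : IntegrableOn f S := by
    refine ((integrableOn_const (C := (1 : ℝ)) hSfin).add hf2).mono' hfm (ae_of_all _ fun x => ?_)
    change ‖f x‖ ≤ 1 + ‖f x‖ ^ 2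
    nlinarith [sq_nonneg (‖f x‖ - 1)]
  rw [← norm_eq_zero]
  refine eq_zero_of_forall_pos_le_mul (N := M * ((∫ x in S, ‖f x‖ ^ 2) + 5)) (norm_nonneg _)
    fun s hs => ?_
  obtain ⟨χ, hχ, hχ1, hχδ⟩ := hcut (s ^ 2) (by positivity)
  set X : ℂ → ℂ := fun x => (χ x : ℂ) with hX
  have hXc : ContDiff ℝ 1 X := Complex.ofRealCLM.contDiff.comp hχ
  have hXd : Differentiable ℝ X := hXc.differentiable one_ne_zero
  have hφd : Differentiable ℝ φ := hφ.differentiable one_ne_zero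
  set Φ : ℂ → ℂ := fun x => S.indicator f x * (φ x * (1 - X x)) with hΦ
  have hsupp : ∀ x ∉ tsupport φ, Φ =ᶠ[nhds x] fun _ => 0 := fun x hx => by
    filter_upwards [notMem_tsupport_iff_eventuallyEq.1 hx] with y hy
    simp [hΦ, hy]
  have hbad : ∀ x ∈ tsupport φ, x ∉ D → Φ =ᶠ[nhds x] fun _ => 0 := fun x hx hxD => by
    filter_upwards [hχ1 x ⟨ball_subset_closedBall (hφs hx), hxD⟩] with y hy
    simp [hΦ, hX, hy]
  have hgood : ∀ x ∈ S, Φ =ᶠ[nhds x] fun y => f y * (φ y * (1 - X y)) := fun x hx => by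
    filter_upwards [hS.mem_nhds hx] with y hy
    simp [hΦ, indicator_of_mem hy]
  have hΦc : ContDiff ℝ 1 Φ := by
    rw [contDiff_iff_contDiffAt]
    intro x
    by_cases hx : x ∈ tsupport φ
    · by_cases hxD : x ∈ D
      · have hxS : x ∈ S := ⟨hxD, hφs hx⟩
        refine ContDiffAt.congr_of_eventuallyEq ?_ (hgood x hxS)
        have : ContDiffAt ℝ 1 f x :=
          ((hf.contDiffOn hS).contDiffAt (hS.mem_nhds hxS)).restrict_scalars ℝ
        exact this.mul (hφ.contDiffAt.mul (contDiffAt_const.sub hXc.contDiffAt))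
      · exact contDiffAt_const.congr_of_eventuallyEq (hbad x hx hxD)
    · exact contDiffAt_const.congr_of_eventuallyEq (hsupp x hx)
  have hΦs : HasCompactSupport Φ := hφcs.mono' fun x hx => by
    by_contra h
    exact hx (hsupp x h).eq_of_nhds
  have hdS : ∀ x ∈ S, dbar Φ x = f x * dbar φ x - f x * (X x * dbar φ x + φ x * dbar X x) := by
    intro x hx
    have hfx : DifferentiableAt ℂ f x := (hf x hx).differentiableAt (hS.mem_nhds hx)
    have h1X : DifferentiableAt ℝ (fun y => 1 - X y) x := (hXd x).const_sub 1
    rw [(hgood x hx).dbar_eq, dbar_mul (hfx.restrictScalars ℝ) ((hφd x).fun_mul h1X),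
      dbar_mul (hφd x) h1X, dbar_eq_zero hfx, dbar_sub (differentiableAt_const 1) (hXd x),
      dbar_const]
    ring
  have hdout : ∀ x ∉ S, dbar Φ x = 0 := by
    intro x hx
    by_cases hxs : x ∈ tsupport φ
    · rw [(hbad x hxs fun h => hx ⟨h, hφs hxs⟩).dbar_eq, dbar_const]
    · rw [(hsupp x hxs).dbar_eq, dbar_const]
  have hdφc := hφ.continuous_dbar
  have hdXc := hXc.continuous_dbar
  have hi1 : IntegrableOn (fun x => f x * dbar φ x) S :=
    hfi.mul_bdd hdφc.aestronglyMeasurable (ae_of_all _ hMd)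
  have hcompl : HasCompactSupport fun x => X x * dbar φ x + φ x * dbar X x :=
    hφcs.dbar.mul_left.add hφcs.mul_right
  have hcont : Continuous fun x => X x * dbar φ x + φ x * dbar X x := by
    have := hXc.continuous
    have := hφ.continuous
    fun_prop
  obtain ⟨M₃, hM₃⟩ := hcompl.exists_bound_of_continuous hcont
  have hi2 : IntegrableOn (fun x => f x * (X x * dbar φ x + φ x * dbar X x)) S :=
    hfi.mul_bdd hcont.aestronglyMeasurable (ae_of_all _ hM₃)
  have hzero := integral_dbar_eq_zero hΦc hΦs
  rw [← setIntegral_eq_integral_of_forall_compl_eq_zero hdout,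
    setIntegral_congr_fun hS.measurableSet hdS, integral_sub hi1 hi2, sub_eq_zero] at hzero
  rw [hzero]
  set e : ℂ → ℝ := fun x => χ x ^ 2 + ‖fderiv ℝ χ x‖ ^ 2 with he
  have hec : Continuous e := by
    have := hχ.continuous_fderiv one_ne_zero
    have := hχ.continuous
    fun_prop
  have hei : IntegrableOn e (closedBall z R) :=
    hec.continuousOn.integrableOn_compact (isCompact_closedBall z R)
  have heS : ∫ x in S, e x ≤ s ^ 2 := (setIntegral_mono_set hei
    (ae_of_all _ fun x => by simp only [he, Pi.zero_apply]; positivity) hSB.eventuallyLE).trans hχδ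
  have hpt : ∀ x, ‖f x * (X x * dbar φ x + φ x * dbar X x)‖
      ≤ M * s * ‖f x‖ ^ 2 + M * 5 * s⁻¹ * e x := by
    intro x
    have hX1 : ‖X x * dbar φ x + φ x * dbar X x‖ ≤ M * (|χ x| + 2 * ‖fderiv ℝ χ x‖) := by
      refine (norm_add_le _ _).trans ?_
      rw [norm_mul, norm_mul, hX, Complex.norm_real, Real.norm_eq_abs, mul_add, mul_comm]
      have := norm_dbar_ofReal_le (hχ.differentiable one_ne_zero x)
      have := hMφ x
      have := hMd x
      gcongr
    rw [norm_mul]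
    set a := |χ x| + 2 * ‖fderiv ℝ χ x‖ with ha
    have ha0 : 0 ≤ a := by positivity
    have ha2 : a ^ 2 ≤ 5 * e x := by
      simp only [ha, he]
      have : |χ x| ^ 2 = χ x ^ 2 := sq_abs _
      nlinarith [sq_nonneg (2 * |χ x| - ‖fderiv ℝ χ x‖)]
    have hyoung : ‖f x‖ * a ≤ s * ‖f x‖ ^ 2 + s⁻¹ * a ^ 2 := by
      have h1 : 0 ≤ s⁻¹ * (s * ‖f x‖ - a) ^ 2 := by positivity
      have h2 : s⁻¹ * (s * ‖f x‖ - a) ^ 2 = s * ‖f x‖ ^ 2 - 2 * (‖f x‖ * a) + s⁻¹ * a ^ 2 := by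
        field_simp
        ring
      nlinarith [norm_nonneg (f x), mul_nonneg (norm_nonneg (f x)) ha0]
    calc ‖f x‖ * ‖X x * dbar φ x + φ x * dbar X x‖ ≤ ‖f x‖ * (M * a) := by gcongr
      _ = M * (‖f x‖ * a) := by ring
      _ ≤ M * (s * ‖f x‖ ^ 2 + s⁻¹ * (5 * e x)) := by
          gcongr
          exact hyoung.trans (by gcongr)
      _ = _ := by ring
  calc ‖∫ x in S, f x * (X x * dbar φ x + φ x * dbar X x)‖
      ≤ ∫ x in S, (M * s * ‖f x‖ ^ 2 + M * 5 * s⁻¹ * e x) :=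
        norm_integral_le_of_norm_le ((hf2.const_mul _).add ((hei.mono_set hSB).const_mul _))
          (ae_of_all _ hpt)
    _ = M * s * (∫ x in S, ‖f x‖ ^ 2) + M * 5 * s⁻¹ * ∫ x in S, e x := by
        rw [integral_add (hf2.const_mul _) ((hei.mono_set hSB).const_mul _), integral_const_mul,
          integral_const_mul]
    _ ≤ M * s * (∫ x in S, ‖f x‖ ^ 2) + M * 5 * s⁻¹ * s ^ 2 := by gcongr
    _ = _ := by field_simp

theorem Real.smoothTransition.deriv_eq_zero_of_neg {x : ℝ} (hx : x < 0) :
    deriv Real.smoothTransition x = 0 := by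
  have : Real.smoothTransition =ᶠ[nhds x] fun _ => 0 := by
    filter_upwards [gt_mem_nhds hx] with y hy using Real.smoothTransition.zero_of_nonpos hy.le
  rw [this.deriv_eq, deriv_const]

theorem Real.smoothTransition.deriv_eq_zero_of_one_lt {x : ℝ} (hx : 1 < x) :
    deriv Real.smoothTransition x = 0 := by
  have : Real.smoothTransition =ᶠ[nhds x] fun _ => 1 := by
    filter_upwards [lt_mem_nhds hx] with y hy using Real.smoothTransition.one_of_one_le hy.le
  rw [this.deriv_eq, deriv_const]

theorem Real.smoothTransition.continuous_deriv : Continuous (deriv Real.smoothTransition) :=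
  (Real.smoothTransition.contDiff (n := 1)).continuous_deriv le_rfl

/-- A radial smooth bump equal to `1` on `ball z s`, supported in `closedBall z (2 * s)`. -/
noncomputable def radialBump (z : ℂ) (s : ℝ) (x : ℂ) : ℂ :=
  (Real.smoothTransition (2 - ‖x - z‖ ^ 2 / s ^ 2) : ℝ)

/-- The quotient of `dbar (radialBump z s)` by `x ↦ x - z`. -/
noncomputable def radialKernel (z : ℂ) (s : ℝ) (x : ℂ) : ℝ :=
  -(2 / s ^ 2 * deriv Real.smoothTransition (2 - ‖x - z‖ ^ 2 / s ^ 2))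

section radialBump

variable {z : ℂ} {s : ℝ}

theorem contDiff_radialBump : ContDiff ℝ 1 (radialBump z s) :=
  Complex.ofRealCLM.contDiff.comp <| Real.smoothTransition.contDiff.comp <|
    contDiff_const.sub ((contDiff_norm_sq ℝ |>.comp (contDiff_id.sub contDiff_const)).div_const _)

theorem continuous_radialKernel : Continuous (radialKernel z s) := by
  have := Real.smoothTransition.continuous_deriv
  unfold radialKernel
  fun_prop

theorem radialBump_eq_one (hs : 0 < s) {x : ℂ} (hx : x ∈ ball z s) : radialBump z s x = 1 := by
  rw [mem_ball, dist_eq_norm] at hx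
  have : ‖x - z‖ ^ 2 / s ^ 2 ≤ 1 := by
    rw [div_le_one (by positivity)]
    gcongr
  rw [radialBump, Real.smoothTransition.one_of_one_le (by linarith), Complex.ofReal_one]

theorem radialBump_eq_zero (hs : 0 < s) {x : ℂ} (hx : x ∉ closedBall z (2 * s)) :
    radialBump z s x = 0 := by
  rw [mem_closedBall, dist_eq_norm, not_le] at hx
  have : 2 ≤ ‖x - z‖ ^ 2 / s ^ 2 := by
    rw [le_div_iff₀ (by positivity)]
    nlinarith
  rw [radialBump, Real.smoothTransition.zero_of_nonpos (by linarith), Complex.ofReal_zero]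

theorem tsupport_radialBump_subset (hs : 0 < s) :
    tsupport (radialBump z s) ⊆ closedBall z (2 * s) :=
  closure_minimal (fun x hx => by by_contra h; exact hx (radialBump_eq_zero hs h))
    isClosed_closedBall

theorem radialKernel_eq_zero_of_mem_ball (hs : 0 < s) {x : ℂ} (hx : x ∈ ball z s) :
    radialKernel z s x = 0 := by
  rw [mem_ball, dist_eq_norm] at hx
  have : ‖x - z‖ ^ 2 / s ^ 2 < 1 := by
    rw [div_lt_one (by positivity)]
    gcongr
  rw [radialKernel, Real.smoothTransition.deriv_eq_zero_of_one_lt (by linarith), mul_zero, neg_zero]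

theorem radialKernel_eq_zero_of_notMem (hs : 0 < s) {x : ℂ} (hx : x ∉ closedBall z (2 * s)) :
    radialKernel z s x = 0 := by
  rw [mem_closedBall, dist_eq_norm, not_le] at hx
  have : 2 < ‖x - z‖ ^ 2 / s ^ 2 := by
    rw [lt_div_iff₀ (by positivity)]
    nlinarith
  rw [radialKernel, Real.smoothTransition.deriv_eq_zero_of_neg (by linarith), mul_zero, neg_zero]

theorem dbar_radialBump (x : ℂ) :
    dbar (radialBump z s) x = radialKernel z s x * (x - z) := by
  have h1 : HasFDerivAt (fun x : ℂ => ‖x - z‖ ^ 2)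
      (2 • (innerSL ℝ (x - z)).comp (ContinuousLinearMap.id ℝ ℂ)) x :=
    ((hasFDerivAt_id x).sub_const z).norm_sq
  have h2 : HasFDerivAt (fun x : ℂ => 2 - ‖x - z‖ ^ 2 / s ^ 2) _ x :=
    (h1.mul_const (s ^ 2)⁻¹).const_sub 2
  have h3 : HasDerivAt Real.smoothTransition
      (deriv Real.smoothTransition (2 - ‖x - z‖ ^ 2 / s ^ 2)) (2 - ‖x - z‖ ^ 2 / s ^ 2) :=
    ((Real.smoothTransition.contDiff (n := 1)).differentiable one_ne_zero _).hasDerivAt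
  have h4 := h3.comp_hasFDerivAt x h2
  have h5 := Complex.ofRealCLM.hasFDerivAt.comp x h4
  have h6 : fderiv ℝ (radialBump z s) x = _ := h5.fderiv
  have h7 : ∀ v, fderiv ℝ (radialBump z s) x v
      = ((radialKernel z s x * inner ℝ (x - z) v : ℝ) : ℂ) := fun v => by
    rw [h6, ContinuousLinearMap.comp_apply, Complex.ofRealCLM_apply]
    congr 1
    simp [radialKernel]
    ring
  rw [dbar, h7, h7]
  generalize radialKernel z s x = k
  apply Complex.ext
  · simp [Complex.inner]
  · simp [Complex.inner]
    left
    ring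

end radialBump

theorem exists_integral_radialKernel : ∃ c : ℂ, c ≠ 0 ∧
    ∀ z : ℂ, ∀ s > 0, ∫ x, (radialKernel z s x : ℂ) = c := by
  set w : ℂ → ℝ := fun x => 2 * deriv Real.smoothTransition (2 - ‖x‖ ^ 2) with hw
  have hwc : Continuous w := by
    have := Real.smoothTransition.continuous_deriv
    fun_prop
  have hws : HasCompactSupport w := HasCompactSupport.intro (isCompact_closedBall 0 2)
    fun x hx => by
      rw [mem_closedBall_zero_iff, not_le] at hx
      simp only [hw]
      rw [Real.smoothTransition.deriv_eq_zero_of_neg (by nlinarith), mul_zero]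
  have hw0 : 0 ≤ w := fun x => mul_nonneg zero_le_two Real.smoothTransition.monotone.deriv_nonneg
  obtain ⟨ξ, hξ, hξd⟩ := exists_deriv_eq_slope Real.smoothTransition zero_lt_one
    Real.smoothTransition.continuous.continuousOn
    ((Real.smoothTransition.contDiff (n := 1)).differentiable one_ne_zero).differentiableOn
  have hpos : 0 < ∫ x, w x := by
    refine hwc.integral_pos_of_hasCompactSupport_nonneg_nonzero hws hw0
      (x := ((√(2 - ξ) : ℝ) : ℂ)) ?_
    simp only [hw, Complex.norm_real, Real.norm_eq_abs, sq_abs]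
    rw [Real.sq_sqrt (by linarith [hξ.2]), sub_sub_cancel, hξd]
    simp
  refine ⟨((-∫ x, w x : ℝ) : ℂ), by simpa using hpos.ne', fun z s hs => ?_⟩
  rw [integral_complex_ofReal]
  congr 1
  rw [← integral_add_right_eq_self _ z]
  have h1 : ∀ x : ℂ, radialKernel z s (x + z) = -((s ^ 2)⁻¹ * w (s⁻¹ • x)) := fun x => by
    simp only [radialKernel, hw, add_sub_cancel_right, norm_smul, norm_inv,
      Real.norm_of_nonneg hs.le, mul_pow, inv_pow]
    rw [div_eq_inv_mul (‖x‖ ^ 2)]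
    ring
  simp_rw [h1]
  rw [integral_neg, integral_const_mul, Measure.integral_comp_inv_smul]
  simp [Complex.finrank_real_complex, hs.ne']

theorem setIntegral_mul_radialKernel {f : ℂ → ℂ} {z : ℂ} {s : ℝ} (hs : 0 < s) {S : Set ℂ}
    (hS : IsOpen S) (hf : DifferentiableOn ℂ f S) (hsub : closedBall z (3 * s) ⊆ S) :
    ∫ x in S, f x * radialKernel z s x = f z * ∫ x, (radialKernel z s x : ℂ) := by
  have hz : z ∈ S := hsub (mem_closedBall_self (by positivity))
  have hbS : ball z (3 * s) ⊆ S := ball_subset_closedBall.trans hsub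
  have hF : DifferentiableOn ℂ (dslope f z) S :=
    (Complex.differentiableOn_dslope (hS.mem_nhds hz)).2 hf
  have hout : ∀ x, x ∉ ball z (3 * s) → radialKernel z s x = 0 := fun x hx =>
    radialKernel_eq_zero_of_notMem hs fun h => hx (closedBall_subset_ball (by linarith) h)
  have hcont : ContinuousOn (fun x => ‖dslope f z x‖ ^ 2) (closedBall z (3 * s)) :=
    (hF.continuousOn.mono hsub).norm.pow 2
  have h0 := integral_mul_dbar_eq_zero hS (z := z) (R := 3 * s)
    (fun δ hδ => ⟨fun _ => 0, contDiff_const, fun x hx => absurd (hsub hx.1) hx.2,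
      by simpa using hδ.le⟩) (hF.mono inter_subset_left)
    ((hcont.integrableOn_compact (isCompact_closedBall _ _)).mono_set
      (inter_subset_right.trans ball_subset_closedBall)) (φ := radialBump z s)
    contDiff_radialBump ((tsupport_radialBump_subset hs).trans (closedBall_subset_ball
      (by linarith)))
  rw [inter_eq_right.2 hbS] at h0
  have hkc : Continuous fun x => (radialKernel z s x : ℂ) :=
    Complex.continuous_ofReal.comp continuous_radialKernel
  have i1 : IntegrableOn (fun x => f z * (radialKernel z s x : ℂ)) (ball z (3 * s)) :=
    ((continuous_const.mul hkc).continuousOn.integrableOn_compact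
      (isCompact_closedBall z (3 * s))).mono_set ball_subset_closedBall
  have i2 : IntegrableOn (fun x => dslope f z x * dbar (radialBump z s) x) (ball z (3 * s)) :=
    (((hF.continuousOn.mono hsub).mul
      contDiff_radialBump.continuous_dbar.continuousOn).integrableOn_compact
      (isCompact_closedBall z (3 * s))).mono_set ball_subset_closedBall
  have e : ∀ x, f x * radialKernel z s x
      = f z * radialKernel z s x + dslope f z x * dbar (radialBump z s) x := fun x => by
    have := sub_smul_dslope f z x
    rw [smul_eq_mul] at this
    rw [dbar_radialBump]
    linear_combination (-(radialKernel z s x : ℂ)) * this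
  calc ∫ x in S, f x * radialKernel z s x = ∫ x in ball z (3 * s), f x * radialKernel z s x := by
        refine setIntegral_eq_of_subset_of_forall_sdiff_eq_zero hS.measurableSet hbS
          fun x hx => ?_
        simp [hout x hx.2]
    _ = f z * ∫ x in ball z (3 * s), (radialKernel z s x : ℂ) := by
        simp_rw [e]
        rw [integral_add i1 i2, h0, add_zero, integral_const_mul]
    _ = _ := by
        rw [setIntegral_eq_integral_of_forall_compl_eq_zero fun x hx => by simp [hout x hx]]

/-- Cauchy–Pompeiu representation of square-integrable holomorphic functions across relatively
closed sets admitting smooth cutoffs of small `W^{1,2}`-norm. -/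
theorem setIntegral_mul_dbar_div_eq {D : Set ℂ} (hD : IsOpen D) {z₀ : ℂ} {R R₀ : ℝ}
    (hR₀ : 0 < R₀) (hR : 2 * R₀ < R)
    (hcut : ∀ δ > 0, ∃ χ : ℂ → ℝ, ContDiff ℝ 1 χ ∧
      (∀ x ∈ closedBall z₀ R \ D, ∀ᶠ y in nhds x, χ y = 1) ∧
      ∫ x in closedBall z₀ R, (χ x ^ 2 + ‖fderiv ℝ χ x‖ ^ 2) ≤ δ)
    {f : ℂ → ℂ} (hf : DifferentiableOn ℂ f (D ∩ ball z₀ R))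
    (hfi : IntegrableOn f (D ∩ ball z₀ R))
    (hf2 : IntegrableOn (fun x => ‖f x‖ ^ 2) (D ∩ ball z₀ R)) {z : ℂ} (hzD : z ∈ D)
    (hz : z ∈ ball z₀ R₀) {c : ℂ}
    (hc : ∀ z : ℂ, ∀ s > 0, ∫ x, (radialKernel z s x : ℂ) = c) :
    ∫ x in D ∩ ball z₀ R, f x * (dbar (radialBump z₀ R₀) x / (x - z)) = c * f z := by
  set S := D ∩ ball z₀ R with hSdef
  have hS : IsOpen S := hD.inter isOpen_ball
  have hzS : z ∈ S ∩ ball z₀ R₀ := ⟨⟨hzD, ball_subset_ball (by linarith) hz⟩, hz⟩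
  obtain ⟨r, hr, hrS⟩ := Metric.isOpen_iff.1 (hS.inter isOpen_ball) z hzS
  set s := r / 4 with hsdef
  have hs : 0 < s := by positivity
  have hsub : closedBall z (3 * s) ⊆ S ∩ ball z₀ R₀ :=
    (closedBall_subset_ball (by linarith)).trans hrS
  set ψ := radialBump z₀ R₀ with hψ
  set θ := radialBump z s with hθ
  have hψc : ContDiff ℝ 1 ψ := contDiff_radialBump
  have hθc : ContDiff ℝ 1 θ := contDiff_radialBump
  have hψd : Differentiable ℝ ψ := hψc.differentiable one_ne_zero
  have hθd : Differentiable ℝ θ := hθc.differentiable one_ne_zero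
  set φ : ℂ → ℂ := fun x => (ψ x - θ x) * (x - z)⁻¹ with hφ
  have hφz : φ =ᶠ[nhds z] fun _ => 0 := by
    filter_upwards [ball_mem_nhds z hs, isOpen_ball.mem_nhds hz] with x hx hx'
    simp [hφ, hψ, hθ, radialBump_eq_one hs hx, radialBump_eq_one hR₀ hx']
  have hφc : ContDiff ℝ 1 φ := by
    rw [contDiff_iff_contDiffAt]
    intro x
    by_cases hx : x = z
    · rw [hx]
      exact contDiffAt_const.congr_of_eventuallyEq hφz
    · exact (hψc.sub hθc).contDiffAt.mul
        ((contDiffAt_id.sub contDiffAt_const).inv (sub_ne_zero.2 hx))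
  have hφs : tsupport φ ⊆ ball z₀ R := by
    refine Subset.trans (closure_minimal (fun x hx => ?_) isClosed_closedBall)
      (closedBall_subset_ball hR)
    by_contra h
    have hxθ : x ∉ closedBall z (2 * s) := fun h' => h <| closedBall_subset_closedBall
      (by linarith) (ball_subset_closedBall
        (hsub (closedBall_subset_closedBall (by linarith) h')).2)
    exact hx (by simp [hφ, hψ, hθ, radialBump_eq_zero hs hxθ, radialBump_eq_zero hR₀ h])
  have hdφ : ∀ x, dbar φ x = dbar ψ x / (x - z) - radialKernel z s x := by
    intro x
    by_cases hx : x = z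
    · rw [hx, hφz.dbar_eq, dbar_const, sub_self, div_zero,
        radialKernel_eq_zero_of_mem_ball hs (mem_ball_self hs), Complex.ofReal_zero, sub_zero]
    · have hxz : x - z ≠ 0 := sub_ne_zero.2 hx
      have hinv : DifferentiableAt ℂ (fun y => (y - z)⁻¹) x :=
        (differentiableAt_id.sub_const z).inv hxz
      rw [hφ, dbar_mul ((hψd x).fun_sub (hθd x)) (hinv.restrictScalars ℝ), dbar_eq_zero hinv,
        dbar_sub (hψd x) (hθd x), hθ, dbar_radialBump (z := z)]
      field_simp
      ring
  have hkc : Continuous fun x => (radialKernel z s x : ℂ) :=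
    Complex.continuous_ofReal.comp continuous_radialKernel
  have hks : HasCompactSupport fun x => (radialKernel z s x : ℂ) :=
    HasCompactSupport.intro (isCompact_closedBall z (2 * s)) fun x hx => by
      rw [radialKernel_eq_zero_of_notMem hs hx, Complex.ofReal_zero]
  have hqc : Continuous fun x => dbar ψ x / (x - z) := by
    have : (fun x => dbar ψ x / (x - z)) = fun x => dbar φ x + radialKernel z s x := by
      funext x; rw [hdφ]; ring
    rw [this]
    exact hφc.continuous_dbar.add hkc
  have hqs : HasCompactSupport fun x => dbar ψ x / (x - z) := by
    simp_rw [div_eq_mul_inv]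
    exact (HasCompactSupport.dbar ((isCompact_closedBall z₀ (2 * R₀)).of_isClosed_subset
      (isClosed_tsupport _) (tsupport_radialBump_subset hR₀))).mul_right
  obtain ⟨M₁, hM₁⟩ := hks.exists_bound_of_continuous hkc
  obtain ⟨M₂, hM₂⟩ := hqs.exists_bound_of_continuous hqc
  have i1 : IntegrableOn (fun x => f x * radialKernel z s x) S :=
    hfi.mul_bdd hkc.aestronglyMeasurable (ae_of_all _ hM₁)
  have i2 : IntegrableOn (fun x => f x * (dbar ψ x / (x - z))) S :=
    hfi.mul_bdd hqc.aestronglyMeasurable (ae_of_all _ hM₂)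
  have h0 := integral_mul_dbar_eq_zero hD hcut hf hf2 hφc hφs
  simp_rw [hdφ, mul_sub] at h0
  rw [integral_sub i2 i1, sub_eq_zero] at h0
  rw [h0, setIntegral_mul_radialKernel hs hS hf (hsub.trans inter_subset_left), hc z s hs, mul_comm]

theorem norm_sq_le_setIntegral_norm_sq {g : ℂ → ℂ} {S : Set ℂ} {w : ℂ} {s : ℝ} (hs : 0 < s)
    (hsub : closedBall w s ⊆ S) (hg : DifferentiableOn ℂ g S)
    (hi : IntegrableOn (fun x => ‖g x‖ ^ 2) S) :
    ‖g w‖ ^ 2 ≤ (s ^ 2 * Real.pi)⁻¹ * ∫ x in S, ‖g x‖ ^ 2 := by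
  have hd : DifferentiableOn ℂ (fun x => g x ^ 2) (closedBall w s) := (hg.mono hsub).pow 2
  have h1 : ∫ x in closedBall w s, g x ^ 2 = ((s ^ 2 * Real.pi : ℝ) : ℂ) * g w ^ 2 := by
    rw [setIntegral_closedBall_eq_circleAverage hd.continuousOn]
    have h2 : ∀ x ∈ closedBall (0 : ℂ) s,
        Real.circleAverage (fun y => g y ^ 2) w ‖x‖ = g w ^ 2 := fun x hx => by
      refine DiffContOnCl.circleAverage (f := fun y => g y ^ 2) ?_
      rw [abs_norm]
      exact (hd.mono (closure_ball_subset_closedBall.trans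
        (closedBall_subset_closedBall (mem_closedBall_zero_iff.1 hx)))).diffContOnCl
    rw [setIntegral_congr_fun measurableSet_closedBall h2, setIntegral_const,
      volume_real_closedBall 0 hs.le, Complex.real_smul]
  have hpos : 0 < s ^ 2 * Real.pi := by positivity
  rw [inv_mul_eq_div, le_div_iff₀' hpos]
  calc s ^ 2 * Real.pi * ‖g w‖ ^ 2 = ‖∫ x in closedBall w s, g x ^ 2‖ := by
        rw [h1, norm_mul, norm_pow, Complex.norm_real, Real.norm_of_nonneg hpos.le]
    _ ≤ ∫ x in closedBall w s, ‖g x ^ 2‖ := norm_integral_le_integral_norm _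
    _ = ∫ x in closedBall w s, ‖g x‖ ^ 2 := by simp_rw [norm_pow]
    _ ≤ ∫ x in S, ‖g x‖ ^ 2 :=
        setIntegral_mono_set hi (ae_of_all _ fun x => by positivity) hsub.eventuallyLE

theorem aestronglyMeasurable_deriv_of_forall {α : Type*} [MeasurableSpace α] {μ : Measure α}
    {g : α → ℂ → ℂ} {w : ℂ} {r : ℝ} (hr : 0 < r)
    (hm : ∀ v ∈ ball w r, AEStronglyMeasurable (fun a => g a v) μ)
    (hd : ∀ᵐ a ∂μ, DifferentiableAt ℂ (g a) w) :
    AEStronglyMeasurable (fun a => deriv (g a) w) μ := by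
  set t : ℕ → ℂ := fun n => ((r / (n + 2) : ℝ) : ℂ) with ht
  have ht0 : Tendsto t atTop (nhdsWithin 0 {0}ᶜ) := by
    refine tendsto_nhdsWithin_iff.2 ⟨?_, Eventually.of_forall fun n => ?_⟩
    · rw [← Complex.ofReal_zero]
      refine (Complex.continuous_ofReal.tendsto _).comp ?_
      exact tendsto_const_nhds.div_atTop
        (tendsto_natCast_atTop_atTop.atTop_add tendsto_const_nhds)
    · have : r / (n + 2 : ℝ) ≠ 0 := by positivity
      simpa only [ht, mem_compl_iff, mem_singleton_iff, Complex.ofReal_eq_zero] using this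
  refine aestronglyMeasurable_of_tendsto_ae atTop (f := fun n a => (t n)⁻¹ • (g a (w + t n) - g a w))
    (fun n => ((hm (w + t n) ?_).sub (hm w (mem_ball_self hr))).const_smul (t n)⁻¹) ?_
  · rw [mem_ball, dist_self_add_left, Complex.norm_real, Real.norm_of_nonneg (by positivity)]
    exact div_lt_self hr (by linarith [n.cast_nonneg (α := ℝ)])
  · filter_upwards [hd] with a ha
    exact ha.hasDerivAt.tendsto_slope_zero.comp ht0

/-- Holomorphic dependence on both parameters of a Cauchy-type integral. -/
theorem differentiableOn_integral_mul_div {μ : Measure ℂ} {g : ℂ → ℂ → ℂ} {a : ℂ → ℂ} {z₀ w₀ : ℂ}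
    {r τ M : ℝ} {B : ℂ → ℝ} (hr : 0 < r) (hτ : 0 < τ) (ha : AEStronglyMeasurable a μ)
    (haM : ∀ x, ‖a x‖ ≤ M) (ha0 : ∀ x ∈ ball z₀ (2 * r), a x = 0)
    (hgm : ∀ w ∈ ball w₀ (2 * τ), AEStronglyMeasurable (fun x => g x w) μ)
    (hgd : ∀ᵐ x ∂μ, DifferentiableOn ℂ (g x) (ball w₀ (2 * τ)))
    (hgB : ∀ᵐ x ∂μ, ∀ w ∈ ball w₀ (2 * τ), ‖g x w‖ ≤ B x) (hB : Integrable B μ) :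
    DifferentiableOn ℂ (fun p : ℂ × ℂ => ∫ x, g x p.2 * (a x / (x - p.1)) ∂μ)
      (ball z₀ r ×ˢ ball w₀ τ) := by
  have hU : IsOpen (ball z₀ r ×ˢ ball w₀ τ) := isOpen_ball.prod isOpen_ball
  have hτ2 : ball w₀ τ ⊆ ball w₀ (2 * τ) := ball_subset_ball (by linarith)
  have hcl : ∀ w ∈ ball w₀ τ, closedBall w τ ⊆ ball w₀ (2 * τ) := fun w hw =>
    closedBall_subset_ball' (by rw [mem_ball] at hw; linarith)
  have hM : 0 ≤ M := (norm_nonneg _).trans (haM 0)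
  have hfar : ∀ z ∈ ball z₀ r, ∀ x, a x ≠ 0 → r ≤ ‖x - z‖ := fun z hz x hx => by
    by_contra! h
    refine hx (ha0 x ?_)
    rw [mem_ball] at hz ⊢
    rw [← dist_eq_norm] at h
    linarith [dist_triangle x z z₀]
  have hb1 : ∀ z ∈ ball z₀ r, ∀ x, ‖a x / (x - z)‖ ≤ M / r := fun z hz x => by
    by_cases hx : a x = 0
    · rw [hx, zero_div, norm_zero]
      positivity
    · rw [norm_div]
      exact div_le_div₀ hM (haM x) hr (hfar z hz x hx)
  have hb2 : ∀ z ∈ ball z₀ r, ∀ x, ‖a x / (x - z) ^ 2‖ ≤ M / r ^ 2 := fun z hz x => by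
    by_cases hx : a x = 0
    · rw [hx, zero_div, norm_zero]
      positivity
    · rw [norm_div, norm_pow]
      exact div_le_div₀ hM (haM x) (by positivity) (by have := hfar z hz x hx; gcongr)
  have hh : ∀ z ∈ ball z₀ r, ∀ x, HasDerivAt (fun z => a x / (x - z)) (a x / (x - z) ^ 2) z :=
    fun z hz x => by
      by_cases hx : a x = 0
      · simpa only [hx, zero_div] using hasDerivAt_const z (0 : ℂ)
      · have hxz : x - z ≠ 0 := norm_pos_iff.1 (hr.trans_le (hfar z hz x hx))
        have := ((hasDerivAt_id z).const_sub x).fun_inv hxz |>.const_mul (a x)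
        simpa [div_eq_mul_inv] using this
  have hms : ∀ z, AEStronglyMeasurable (fun x => a x / (x - z)) μ := fun z =>
    (ha.aemeasurable.div (measurable_id.sub_const z).aemeasurable).aestronglyMeasurable
  have hms2 : ∀ z, AEStronglyMeasurable (fun x => a x / (x - z) ^ 2) μ := fun z =>
    (ha.aemeasurable.div ((measurable_id.sub_const z).pow_const 2).aemeasurable).aestronglyMeasurable
  intro p hp
  have hda : AEStronglyMeasurable (fun x => deriv (g x) p.2) μ :=
    aestronglyMeasurable_deriv_of_forall hτ
      (fun v hv => hgm v (hcl _ hp.2 (ball_subset_closedBall hv))) (by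
        filter_upwards [hgd] with x hx
        exact hx.differentiableAt (isOpen_ball.mem_nhds (hτ2 hp.2)))
  refine (hasFDerivAt_integral_of_dominated_of_fderiv_le
    (F' := fun p x => (g x p.2 * (a x / (x - p.1) ^ 2)) • ContinuousLinearMap.fst ℂ ℂ ℂ
      + (a x / (x - p.1) * deriv (g x) p.2) • ContinuousLinearMap.snd ℂ ℂ ℂ)
    (bound := fun x => (M / r ^ 2 + M / r * τ⁻¹) * B x)
    (hU.mem_nhds hp) ?_ ?_ ?_ ?_ (hB.const_mul _) ?_).differentiableAt.differentiableWithinAt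
  · filter_upwards [hU.mem_nhds hp] with q hq
    exact (hgm _ (hτ2 hq.2)).mul (hms _)
  · refine Integrable.mono' (hB.const_mul (M / r)) ((hgm _ (hτ2 hp.2)).mul (hms _)) ?_
    filter_upwards [hgB] with x hx
    rw [norm_mul, mul_comm]
    exact mul_le_mul (hb1 _ hp.1 x) (hx _ (hτ2 hp.2)) (norm_nonneg _) (by positivity)
  · exact (((hgm _ (hτ2 hp.2)).mul (hms2 _)).smul_const _).add
      (((hms _).mul hda).smul_const _)
  · filter_upwards [hgB, hgd] with x hx hxd q hq
    have hd : ‖deriv (g x) q.2‖ ≤ B x / τ := by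
      refine Complex.norm_deriv_le_of_forall_mem_sphere_norm_le hτ
        (hxd.mono (closure_ball_subset_closedBall.trans (hcl _ hq.2))).diffContOnCl
        fun v hv => hx v (hcl _ hq.2 (sphere_subset_closedBall hv))
    have hB0 : 0 ≤ B x := (norm_nonneg _).trans (hx _ (hτ2 hq.2))
    calc _ ≤ ‖g x q.2 * (a x / (x - q.1) ^ 2)‖ * 1 + ‖a x / (x - q.1) * deriv (g x) q.2‖ * 1 := by
          refine (norm_add_le _ _).trans ?_
          rw [norm_smul, norm_smul]
          gcongr
          · exact ContinuousLinearMap.norm_fst_le ℂ ℂ ℂ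
          · exact ContinuousLinearMap.norm_snd_le ℂ ℂ ℂ
      _ ≤ B x * (M / r ^ 2) + M / r * (B x / τ) := by
          rw [mul_one, mul_one, norm_mul, norm_mul]
          gcongr
          · exact hx _ (hτ2 hq.2)
          · exact hb2 _ hq.1 x
          · exact hb1 _ hq.1 x
      _ = _ := by ring
  · filter_upwards [hgd] with x hx q hq
    have h1 : HasFDerivAt (fun p : ℂ × ℂ => g x p.2)
        (deriv (g x) q.2 • ContinuousLinearMap.snd ℂ ℂ ℂ) q :=
      (hx.differentiableAt (isOpen_ball.mem_nhds (hτ2 hq.2))).hasDerivAt.comp_hasFDerivAt q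
        hasFDerivAt_snd
    have h2 : HasFDerivAt (fun p : ℂ × ℂ => a x / (x - p.1))
        ((a x / (x - q.1) ^ 2) • ContinuousLinearMap.fst ℂ ℂ ℂ) q :=
      (hh _ hq.1 x).comp_hasFDerivAt q hasFDerivAt_fst
    simp only [mul_smul]
    exact h1.mul h2

/-- Square-integrable holomorphic functions extend holomorphically in the first variable across
relatively closed sets admitting smooth cutoffs of small `W^{1,2}`-norm. -/
theorem exists_differentiableOn_extension {D : Set ℂ} (hD : IsOpen D) {z₀ w₀ : ℂ} {R τ : ℝ}
    (hR : 0 < R) (hτ : 0 < τ)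
    (hcut : ∀ δ > 0, ∃ χ : ℂ → ℝ, ContDiff ℝ 1 χ ∧
      (∀ x ∈ closedBall z₀ R \ D, ∀ᶠ y in nhds x, χ y = 1) ∧
      ∫ x in closedBall z₀ R, (χ x ^ 2 + ‖fderiv ℝ χ x‖ ^ 2) ≤ δ)
    {f : ℂ × ℂ → ℂ} (hf : DifferentiableOn ℂ f ((D ∩ ball z₀ R) ×ˢ ball w₀ τ))
    (hf2 : IntegrableOn (fun p => ‖f p‖ ^ 2) ((D ∩ ball z₀ R) ×ˢ ball w₀ τ)) :
    ∃ r > 0, ∃ F : ℂ × ℂ → ℂ, DifferentiableOn ℂ F (ball z₀ r ×ˢ ball w₀ r) ∧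
      ∀ p ∈ ball z₀ r ×ˢ ball w₀ r, p.1 ∈ D → F p = f p := by
  set S := D ∩ ball z₀ R with hSdef
  have hS : IsOpen S := hD.inter isOpen_ball
  have hSfin : volume S < ⊤ := (measure_mono inter_subset_right).trans_lt measure_ball_lt_top
  have hprod : Integrable (fun p : ℂ × ℂ => ‖f p‖ ^ 2)
      ((volume.restrict S).prod (volume.restrict (ball w₀ τ))) := by
    rw [Measure.prod_restrict]
    exact hf2
  set k : ℂ → ℝ := fun x => ∫ w in ball w₀ τ, ‖f (x, w)‖ ^ 2 with hk
  have hki : IntegrableOn k S := hprod.integral_prod_left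
  have hk2 := hprod.prod_right_ae
  have hS2 : ∀ᵐ x ∂volume.restrict S, x ∈ S := ae_restrict_mem hS.measurableSet
  have hd1 : ∀ x ∈ S, DifferentiableOn ℂ (fun w => f (x, w)) (ball w₀ τ) := fun x hx =>
    hf.comp ((differentiableOn_const x).prodMk differentiableOn_id) fun w hw => ⟨hx, hw⟩
  have hd2 : ∀ w ∈ ball w₀ τ, DifferentiableOn ℂ (fun x => f (x, w)) S := fun w hw =>
    hf.comp (differentiableOn_id.prodMk (differentiableOn_const w)) fun x hx => ⟨hx, hw⟩
  set C := ((τ / 4) ^ 2 * Real.pi)⁻¹ with hC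
  have hCk : ∀ᵐ x ∂volume.restrict S, ∀ w ∈ ball w₀ (τ / 2), ‖f (x, w)‖ ^ 2 ≤ C * k x := by
    filter_upwards [hk2, hS2] with x hx hxS w hw
    refine norm_sq_le_setIntegral_norm_sq (g := fun w => f (x, w)) (by positivity)
      (closedBall_subset_ball' ?_) (hd1 x hxS) hx
    rw [mem_ball] at hw
    linarith
  have hB : IntegrableOn (fun x => 1 + C * k x) S :=
    (integrableOn_const hSfin.ne).add (hki.const_mul C)
  have hfB : ∀ᵐ x ∂volume.restrict S, ∀ w ∈ ball w₀ (τ / 2), ‖f (x, w)‖ ≤ 1 + C * k x := by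
    filter_upwards [hCk] with x hx w hw
    nlinarith [hx w hw, sq_nonneg (‖f (x, w)‖ - 1), norm_nonneg (f (x, w))]
  have hτ2 : ball w₀ (τ / 2) ⊆ ball w₀ τ := ball_subset_ball (by linarith)
  have hfm : ∀ w ∈ ball w₀ (τ / 2), AEStronglyMeasurable (fun x => f (x, w)) (volume.restrict S) :=
    fun w hw => (hd2 w (hτ2 hw)).continuousOn.aestronglyMeasurable hS.measurableSet
  obtain ⟨c, hc0, hc⟩ := exists_integral_radialKernel
  set R₀ := R / 3 with hR₀
  set ψ := radialBump z₀ R₀ with hψ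
  have hR₀p : 0 < R₀ := by positivity
  have hψc : Continuous (dbar ψ) := contDiff_radialBump.continuous_dbar
  obtain ⟨M, hM⟩ := (HasCompactSupport.dbar (((isCompact_closedBall z₀ (2 * R₀)).of_isClosed_subset
      (isClosed_tsupport _) (tsupport_radialBump_subset hR₀p)))).exists_bound_of_continuous hψc
  have hψ0 : ∀ x ∈ ball z₀ (2 * (R₀ / 2)), dbar ψ x = 0 := fun x hx => by
    rw [mul_div_cancel₀ _ two_ne_zero] at hx
    rw [hψ, dbar_radialBump, radialKernel_eq_zero_of_mem_ball hR₀p hx, Complex.ofReal_zero,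
      zero_mul]
  have hdiff := differentiableOn_integral_mul_div (μ := volume.restrict S) (w₀ := w₀)
    (r := R₀ / 2) (τ := τ / 4) (g := fun x w => f (x, w))
    (by positivity) (by positivity) hψc.aestronglyMeasurable hM hψ0
    (by rwa [show 2 * (τ / 4) = τ / 2 by ring])
    (by
      rw [show 2 * (τ / 4) = τ / 2 by ring]
      filter_upwards [hS2] with x hx using (hd1 x hx).mono hτ2)
    (by rwa [show 2 * (τ / 4) = τ / 2 by ring]) hB
  refine ⟨min (R₀ / 2) (τ / 4), by positivity, _, (hdiff.const_mul c⁻¹).mono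
    (prod_mono (ball_subset_ball (min_le_left _ _)) (ball_subset_ball (min_le_right _ _))),
    fun p hp hpD => ?_⟩
  have hw : p.2 ∈ ball w₀ (τ / 2) :=
    ball_subset_ball ((min_le_right _ _).trans (by linarith)) hp.2
  rw [inv_mul_eq_iff_eq_mul₀ hc0]
  refine setIntegral_mul_dbar_div_eq hD hR₀p (by rw [hR₀]; linarith) hcut (hd2 _ (hτ2 hw))
    (Integrable.mono' hB (hfm _ hw) (hfB.mono fun x hx => hx _ hw))
    (Integrable.mono' (hki.const_mul C) ((hfm _ hw).norm.pow 2) (hCk.mono fun x hx => ?_)) hpD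
    (ball_subset_ball ((min_le_left _ _).trans (by linarith)) hp.1) hc
  rw [Real.norm_of_nonneg (by positivity)]
  exact hx _ hw

theorem elog_lt_coe_iff {x t : ℝ} : elog x < (t : EReal) ↔ x < Real.exp t := by
  rw [elog]
  split_ifs with hx
  · exact iff_of_true (EReal.bot_lt_coe t) (hx.trans_lt (Real.exp_pos t))
  · rw [EReal.coe_lt_coe_iff, Real.log_lt_iff_lt_exp (not_le.1 hx)]

theorem mem_hartogs_iff {D : Set ℂ} {ρ : ℂ → EReal} {p : ℂ × ℂ} :
    p ∈ hartogs D ρ ↔ p.1 ∈ D ∧ ∃ t : ℝ, ‖p.2‖ < Real.exp t ∧ ρ p.1 < -(t : EReal) := by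
  change p.1 ∈ D ∧ elog ‖p.2‖ < -ρ p.1 ↔ _
  rw [EReal.lt_iff_exists_real_btwn]
  simp only [elog_lt_coe_iff, EReal.lt_neg_comm (a := ((_ : ℝ) : EReal))]

theorem isOpen_hartogs {D : Set ℂ} (hD : IsOpen D) {ρ : ℂ → EReal}
    (hρ : UpperSemicontinuousOn ρ D) : IsOpen (hartogs D ρ) := by
  rw [isOpen_iff_mem_nhds]
  intro p hp
  obtain ⟨hpD, t, ht, hρt⟩ := mem_hartogs_iff.1 hp
  have h1 : ∀ᶠ z in nhds p.1, ρ z < -(t : EReal) := by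
    have := hρ p.1 hpD _ hρt
    rwa [hD.nhdsWithin_eq hpD] at this
  filter_upwards [continuousAt_fst.eventually (h1.and (hD.mem_nhds hpD)),
    continuousAt_snd.norm.eventually_lt_const ht] with q hq hq2
  exact mem_hartogs_iff.2 ⟨hq.2, t, hq2, hq.1⟩

/-- Near a point of `S(D)` the complement of `D` is null and admits smooth cutoffs of arbitrarily
small `W^{1,2}`-norm. -/
theorem exists_cutoffs_of_mem_polarS {D : Set ℂ} (hD : IsOpen D) {z : ℂ} (hz : z ∈ polarS D)
    {V : Set ℂ} (hV : V ∈ nhds z) :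
    ∃ R > 0, ball z R ⊆ V ∧ volume (ball z R \ D) = 0 ∧
      ∀ δ > 0, ∃ χ : ℂ → ℝ, ContDiff ℝ 1 χ ∧
        (∀ x ∈ closedBall z R \ D, ∀ᶠ y in nhds x, χ y = 1) ∧
        ∫ x in closedBall z R, (χ x ^ 2 + ‖fderiv ℝ χ x‖ ^ 2) ≤ δ := by
  obtain ⟨hzf, U, hU, hzU, Ω, hΩ, u, hu, hubot⟩ := hz
  have hzD : z ∉ D := (hD.frontier_eq ▸ hzf).2
  obtain ⟨R₁, hR₁, hnull, hcut⟩ := hu.exists_cutoffs (hΩ ⟨hzU, hzD⟩)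
  obtain ⟨R₂, hR₂, hR₂U⟩ := nhds_basis_closedBall.mem_iff.1 (inter_mem (hU.mem_nhds hzU) hV)
  set R := min R₁ R₂ with hR
  have hsub1 : closedBall z R ⊆ closedBall z R₁ := closedBall_subset_closedBall (min_le_left _ _)
  have hsub2 : closedBall z R ⊆ U ∩ V :=
    (closedBall_subset_closedBall (min_le_right _ _)).trans hR₂U
  have hbot : ∀ x ∈ closedBall z R \ D, u x = ⊥ := fun x hx => hubot x ⟨(hsub2 hx.1).1, hx.2⟩
  have hsub3 : ball z R \ D ⊆ {x | u x = ⊥} ∩ ball z R₁ := fun x hx =>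
    ⟨hbot x ⟨ball_subset_closedBall hx.1, hx.2⟩, ball_subset_ball (min_le_left _ _) hx.1⟩
  refine ⟨R, lt_min hR₁ hR₂, fun x hx => (hsub2 (ball_subset_closedBall hx)).2,
    measure_mono_null hsub3 hnull, fun δ hδ => ?_⟩
  obtain ⟨χ, hχ, hχ1, hχδ⟩ := hcut (closedBall z R \ D) ((isCompact_closedBall z R).diff hD)
    (sdiff_subset.trans hsub1) hbot δ hδ
  refine ⟨χ, hχ, hχ1, le_trans (setIntegral_mono_set ?_ (ae_of_all _ fun x => by positivity)
    hsub1.eventuallyLE) hχδ⟩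
  have := hχ.continuous
  have := hχ.continuous_fderiv one_ne_zero
  exact (Continuous.continuousOn (by fun_prop)).integrableOn_compact (isCompact_closedBall z R₁)

theorem subset_closure_of_volume_diff_eq_zero {D U : Set ℂ} (hU : IsOpen U)
    (h : volume (U \ D) = 0) : U ⊆ closure (D ∩ U) := by
  intro x hx
  rw [_root_.mem_closure_iff]
  intro o ho hxo
  by_contra hne
  have hpos : 0 < volume (o ∩ U) := (ho.inter hU).measure_pos volume ⟨x, hxo, hx⟩
  have hsub : o ∩ U ⊆ U \ D := fun y hy => ⟨hy.2, fun hyD => hne ⟨y, hy.1, hyD, hy.2⟩⟩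
  exact hpos.ne' (measure_mono_null hsub h)

theorem volume_dHat_diff {D : Set ℂ} (hD : IsOpen D) (ρ : ℂ → EReal) :
    volume (DHat D ρ \ D) = 0 := by
  refine measure_null_of_locally_null _ fun z hz => ?_
  obtain ⟨R, hR, -, hnull, -⟩ :=
    exists_cutoffs_of_mem_polarS hD (hz.1.resolve_left hz.2).1 univ_mem
  have hsub : (DHat D ρ \ D) ∩ ball z R ⊆ ball z R \ D := fun x hx => ⟨hx.2, hx.1.2⟩
  exact ⟨(DHat D ρ \ D) ∩ ball z R, inter_mem_nhdsWithin _ (ball_mem_nhds z hR),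
    measure_mono_null hsub hnull⟩

theorem hartogs_subset_hartogs_dHat (D : Set ℂ) (ρ : ℂ → EReal) :
    hartogs D ρ ⊆ hartogs (DHat D ρ) (rhoHat D ρ) := fun p hp =>
  ⟨Or.inl hp.1, by rw [rhoHat, if_pos hp.1]; exact hp.2⟩

theorem mem_hartogs_of_mem_hartogs_dHat {D : Set ℂ} {ρ : ℂ → EReal} {p : ℂ × ℂ}
    (hp : p ∈ hartogs (DHat D ρ) (rhoHat D ρ)) (hpD : p.1 ∈ D) : p ∈ hartogs D ρ :=
  ⟨hpD, by have := hp.2; rwa [rhoHat, if_pos hpD] at this⟩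

theorem hartogs_dHat_ae_eq {D : Set ℂ} (hD : IsOpen D) (ρ : ℂ → EReal) :
    hartogs (DHat D ρ) (rhoHat D ρ) =ᵐ[volume] hartogs D ρ := by
  refine (ae_le_set.2 (measure_mono_null (t := (DHat D ρ \ D) ×ˢ univ) (fun p hp => ?_) ?_)).antisymm
    (hartogs_subset_hartogs_dHat D ρ).eventuallyLE
  · exact ⟨⟨hp.1.1, fun h => hp.2 (mem_hartogs_of_mem_hartogs_dHat hp.1 h)⟩, mem_univ _⟩
  · rw [Measure.volume_eq_prod, Measure.prod_prod, volume_dHat_diff hD, zero_mul]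

/-- Around each added point, `G_{D,ρ}` contains a punctured polydisc whose deleted set is
negligible for square-integrable holomorphic functions. -/
theorem exists_polydisc_of_mem_hartogs_dHat {D : Set ℂ} (hD : IsOpen D) {ρ : ℂ → EReal} {p : ℂ × ℂ}
    (hp : p ∈ hartogs (DHat D ρ) (rhoHat D ρ)) (hpD : p.1 ∉ D) :
    ∃ R > 0, ∃ τ > 0, (D ∩ ball p.1 R) ×ˢ ball p.2 τ ⊆ hartogs D ρ ∧
      ball p.1 R ⊆ closure (D ∩ ball p.1 R) ∧
      ∀ δ > 0, ∃ χ : ℂ → ℝ, ContDiff ℝ 1 χ ∧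
        (∀ x ∈ closedBall p.1 R \ D, ∀ᶠ y in nhds x, χ y = 1) ∧
        ∫ x in closedBall p.1 R, (χ x ^ 2 + ‖fderiv ℝ χ x‖ ^ 2) ≤ δ := by
  obtain ⟨hpH, t, ht, hρt⟩ := mem_hartogs_iff.1 hp
  rw [rhoHat, if_neg hpD] at hρt
  have hev := eventually_nhdsWithin_iff.1 (eventually_lt_of_limsup_lt hρt)
  obtain ⟨R, hR, hRV, hnull, hcut⟩ :=
    exists_cutoffs_of_mem_polarS hD (hpH.resolve_left hpD).1 hev
  refine ⟨R, hR, Real.exp t - ‖p.2‖, sub_pos.2 ht, fun q hq => ?_,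
    subset_closure_of_volume_diff_eq_zero isOpen_ball hnull, hcut⟩
  refine mem_hartogs_iff.2 ⟨hq.1.1, t, ?_, hRV hq.1.2 hq.1.1⟩
  have := hq.2
  rw [mem_ball, dist_eq_norm] at this
  linarith [norm_le_norm_add_norm_sub' q.2 p.2]

theorem hartogs_dHat_subset_closure {D : Set ℂ} (hD : IsOpen D) (ρ : ℂ → EReal) :
    hartogs (DHat D ρ) (rhoHat D ρ) ⊆ closure (hartogs D ρ) := by
  intro p hp
  by_cases hpD : p.1 ∈ D
  · exact subset_closure (mem_hartogs_of_mem_hartogs_dHat hp hpD)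
  · obtain ⟨R, hR, τ, hτ, hsub, hcl, -⟩ := exists_polydisc_of_mem_hartogs_dHat hD hp hpD
    refine closure_mono hsub ?_
    rw [closure_prod_eq]
    exact ⟨hcl (mem_ball_self hR), subset_closure (mem_ball_self hτ)⟩

theorem differentiableAt_extendFrom_hartogs {D : Set ℂ} (hD : IsOpen D) {ρ : ℂ → EReal}
    (hρ : UpperSemicontinuousOn ρ D) {f : ℂ × ℂ → ℂ} (hf : f ∈ L2h (hartogs D ρ)) {p : ℂ × ℂ}
    (hp : p ∈ hartogs (DHat D ρ) (rhoHat D ρ)) :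
    DifferentiableAt ℂ (extendFrom (hartogs D ρ) f) p := by
  have hG := isOpen_hartogs hD hρ
  by_cases hpD : p.1 ∈ D
  · have hpG := mem_hartogs_of_mem_hartogs_dHat hp hpD
    refine (hf.1.differentiableAt (hG.mem_nhds hpG)).congr_of_eventuallyEq ?_
    filter_upwards [hG.mem_nhds hpG] with q hq
    exact extendFrom_eq (subset_closure hq) (hf.1.continuousOn q hq)
  · obtain ⟨R, hR, τ, hτ, hsub, hcl, hcut⟩ := exists_polydisc_of_mem_hartogs_dHat hD hp hpD
    obtain ⟨r, hr, F, hF, hFf⟩ := exists_differentiableOn_extension hD hR hτ hcut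
      (hf.1.mono hsub) (hf.2.mono_set hsub)
    have hW : IsOpen (ball p.1 r ×ˢ ball p.2 r) := isOpen_ball.prod isOpen_ball
    have hpW : p ∈ ball p.1 r ×ˢ ball p.2 r := ⟨mem_ball_self hr, mem_ball_self hr⟩
    refine (hF.differentiableAt (hW.mem_nhds hpW)).congr_of_eventuallyEq ?_
    filter_upwards [hW.mem_nhds hpW,
      (isOpen_ball.prod isOpen_ball).mem_nhds
        (⟨mem_ball_self hR, mem_ball_self hτ⟩ : p ∈ ball p.1 R ×ˢ ball p.2 τ)] with q hq hq2
    refine extendFrom_eq (closure_mono hsub ?_) ?_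
    · rw [closure_prod_eq]
      exact ⟨hcl hq2.1, subset_closure hq2.2⟩
    · refine ((hF.continuousOn.continuousAt (hW.mem_nhds hq)).tendsto.mono_left
        nhdsWithin_le_nhds).congr' ?_
      filter_upwards [self_mem_nhdsWithin, mem_nhdsWithin_of_mem_nhds (hW.mem_nhds hq)] with x hx hxW
      exact hFf x hxW hx.1

/-- For `ρ` subharmonic on the domain `D` and bounded from below, every
`f ∈ L²ₕ(G_{D,ρ})` extends to a unique `F ∈ L²ₕ(G_{D̂,ρ̂})`; i.e. the restriction map
`L²ₕ(G_{D̂,ρ̂}) → L²ₕ(G_{D,ρ})` is a bijection. -/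
theorem extension_to_dhat (D : Set ℂ) (hDopen : IsOpen D) (hDconn : IsConnected D)
    (ρ : ℂ → EReal) (hρ : SubharmonicOn ρ D) (hbd : ∃ M : ℝ, ∀ z ∈ D, (M : EReal) ≤ ρ z) :
    (∀ f ∈ L2h (hartogs D ρ), ∃ F ∈ L2h (hartogs (DHat D ρ) (rhoHat D ρ)),
        Set.EqOn F f (hartogs D ρ)) ∧
      ∀ F₁ ∈ L2h (hartogs (DHat D ρ) (rhoHat D ρ)),
        ∀ F₂ ∈ L2h (hartogs (DHat D ρ) (rhoHat D ρ)),
          Set.EqOn F₁ F₂ (hartogs D ρ) →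
            Set.EqOn F₁ F₂ (hartogs (DHat D ρ) (rhoHat D ρ)) := by
  refine ⟨fun f hf => ?_, fun F₁ hF₁ F₂ hF₂ h => ?_⟩
  · have heq : EqOn (extendFrom (hartogs D ρ) f) f (hartogs D ρ) := fun p hp =>
      extendFrom_eq (subset_closure hp) (hf.1.continuousOn p hp)
    refine ⟨extendFrom (hartogs D ρ) f, ⟨fun p hp =>
      (differentiableAt_extendFrom_hartogs hDopen hρ.2.1 hf hp).differentiableWithinAt, ?_⟩, heq⟩
    refine IntegrableOn.congr_set_ae ?_ (hartogs_dHat_ae_eq hDopen ρ)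
    exact hf.2.congr_fun (fun p hp => by simp only [heq hp])
      (isOpen_hartogs hDopen hρ.2.1).measurableSet
  · exact h.of_subset_closure hF₁.1.continuousOn hF₂.1.continuousOn
      (hartogs_subset_hartogs_dHat D ρ) (hartogs_dHat_subset_closure hDopen ρ)
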